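/- arXiv:1111.7109 — 2 statements merged into one kernel-verified Lean document; each statement's English description precedes it below -/
import Mathlib

section
/- Let 𝒢 be a closed subgroup of Sym(P) which contains every rotation of P and which contains some permutation that is not a rotation of P. Then 𝒢 contains every permutation of P that preserves the relation Pari. -/
variable {P : Type} [PartialOrder P]

/-- `a` and `b` are incomparable elements of the partial order `P`. -/
def Perp (a b : P) : Prop := ¬ a ≤ b ∧ ¬ b ≤ a

/-- `f` is an order-automorphism of `P`. -/
def IsOrderAuto (f : Equiv.Perm P) : Prop := ∀ a b : P, f a ≤ f b ↔ a ≤ b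

/-- `f` is an anti-automorphism of `P`. -/
def IsAntiAuto (f : Equiv.Perm P) : Prop := ∀ a b : P, f a ≤ f b ↔ b ≤ a

/-- Every finite partial order embeds into `P` (universality). -/
def IsUniversal (P : Type) [PartialOrder P] : Prop :=
  ∀ (Q : Type) [PartialOrder Q] [Fintype Q], Nonempty (Q ↪o P)

/-- Every order-isomorphism between two finite subsets of `P` extends to an
order-automorphism of `P` (homogeneity). -/
def IsHomogeneous (P : Type) [PartialOrder P] : Prop :=
  ∀ (S T : Finset P) (e : (S : Set P) ≃o (T : Set P)),
    ∃ g : P ≃o P, ∀ x : (S : Set P), g ↑x = ↑(e x)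

/-- A subgroup of `Sym(P)` is closed iff it contains every permutation that agrees
with one of its members on each finite subset of `P`. -/
def IsClosedSubgroup (G : Subgroup (Equiv.Perm P)) : Prop :=
  ∀ f : Equiv.Perm P,
    (∀ S : Finset P, ∃ g ∈ G, ∀ x ∈ S, (g : Equiv.Perm P) x = f x) → f ∈ G

/-- `h` is an order-automorphism of `P` fixing each of the constants `c i`. -/
def FixingAuto (n : ℕ) (c : Fin n → P) (h : Equiv.Perm P) : Prop :=
  IsOrderAuto h ∧ ∀ i : Fin n, h (c i) = c i

/-- `X` is an orbit of `(P, c₁, …, cₙ)`, i.e. an orbit of the action on `P` of the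
group of automorphisms of `P` fixing each `c i`. -/
def IsOrbit (n : ℕ) (c : Fin n → P) (X : Set P) : Prop :=
  ∃ x : P, X = {y | ∃ h : Equiv.Perm P, FixingAuto n c h ∧ h x = y}

/-- `g` is canonical as a function from `(P, c₁, …, cₙ)` to `P`. -/
def Canonical (n : ℕ) (c : Fin n → P) (g : P → P) : Prop :=
  ∀ (m : ℕ) (a b : Fin m → P),
    (∃ h : Equiv.Perm P, FixingAuto n c h ∧ ∀ j : Fin m, h (a j) = b j) →
    ∃ h' : Equiv.Perm P, IsOrderAuto h' ∧ ∀ j : Fin m, h' (g (a j)) = g (b j)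

/-- `g` is M-generated by the subgroup `G` of `Sym(P)`: on every finite subset of `P`
it agrees with some member of `G`. -/
def MGen (G : Subgroup (Equiv.Perm P)) (g : P → P) : Prop :=
  ∀ S : Finset P, ∃ h ∈ G, ∀ x ∈ S, (h : Equiv.Perm P) x = g x

/-- `g` behaves like `id` on `X`. -/
def BehavesLikeId (g : P → P) (X : Set P) : Prop :=
  ∀ x ∈ X, ∀ x' ∈ X, (x < x' → g x < g x') ∧ (Perp x x' → Perp (g x) (g x'))

/-- `g` behaves like `↕` on `X`. -/
def BehavesLikeRev (g : P → P) (X : Set P) : Prop :=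
  ∀ x ∈ X, ∀ x' ∈ X, (x < x' → g x' < g x) ∧ (Perp x x' → Perp (g x) (g x'))

/-- `g` behaves like `id` between `X` and `Y`. -/
def BehavesLikeIdBetween (g : P → P) (X Y : Set P) : Prop :=
  ∀ x ∈ X, ∀ y ∈ Y,
    (x < y → g x < g y) ∧ (y < x → g y < g x) ∧ (Perp x y → Perp (g x) (g y))

/-- `X ≤ Y` for subsets: some element of `X` lies below some element of `Y`. -/
def SetLE (X Y : Set P) : Prop := ∃ x ∈ X, ∃ y ∈ Y, x ≤ y

/-- `X < Y` for subsets: every element of `X` lies strictly below every element of `Y`. -/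
def SetLT (X Y : Set P) : Prop := ∀ x ∈ X, ∀ y ∈ Y, x < y

/-- The relation `X ÷ Y`. -/
def SetDiv (X Y : Set P) : Prop :=
  (SetLE X Y ∧ ¬ SetLE Y X ∧ ¬ SetLT X Y) ∨ (SetLE Y X ∧ ¬ SetLE X Y ∧ ¬ SetLT Y X)

/-- `f` is a rotation of `P`. -/
def IsRotation (f : Equiv.Perm P) : Prop :=
  ∃ X Y Z : Set P,
    (∀ p : P, p ∈ X ∨ p ∈ Y ∨ p ∈ Z) ∧
    Disjoint X Y ∧ Disjoint X Z ∧ Disjoint Y Z ∧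
    IsLowerSet X ∧ IsUpperSet Z ∧
    (∀ x ∈ X, ∀ z ∈ Z, x < z) ∧
    BehavesLikeId (⇑f) X ∧ BehavesLikeId (⇑f) Y ∧ BehavesLikeId (⇑f) Z ∧
    (∀ x ∈ X, ∀ z ∈ Z, f z < f x) ∧
    (∀ x ∈ X, ∀ y ∈ Y, (f y < f x ↔ Perp x y) ∧ (Perp (f x) (f y) ↔ x < y)) ∧
    (∀ y ∈ Y, ∀ z ∈ Z, (f z < f y ↔ Perp y z) ∧ (Perp (f y) (f z) ↔ y < z))

/-- The ternary relation `Cyc`. -/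
def Cyc (a b c : P) : Prop :=
  (a < b ∧ b < c) ∨ (b < c ∧ c < a) ∨ (c < a ∧ a < b) ∨
  (a < b ∧ Perp c a ∧ Perp c b) ∨ (b < c ∧ Perp a b ∧ Perp a c) ∨
  (c < a ∧ Perp b a ∧ Perp b c)

/-- The ternary relation `Cyc'`, the dual of `Cyc`. -/
def Cyc' (a b c : P) : Prop := Cyc c b a

/-- The ternary relation `Pari`. -/
def Pari (a b c : P) : Prop :=
  (Perp a b ∧ Perp b c ∧ Perp a c) ∨
  (a < b ∧ a < c ∧ Perp b c) ∨ (b < a ∧ b < c ∧ Perp a c) ∨ (c < a ∧ c < b ∧ Perp a b) ∨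
  (b < a ∧ c < a ∧ Perp b c) ∨ (a < b ∧ c < b ∧ Perp a c) ∨ (a < c ∧ b < c ∧ Perp a b)

/-- `f` preserves the ternary relation `R`. -/
def Preserves3 (f : P → P) (R : P → P → P → Prop) : Prop :=
  ∀ a b c : P, R a b c ↔ R (f a) (f b) (f c)

/-- `UltraLim U k F A c` says that `c` is the iterated limit along `U` of the colours
`F (A ∪ {a₁, …, aₖ})`. -/
def UltraLim {K : Type} (U : Ultrafilter ℕ) : ℕ → (Finset ℕ → K) → Finset ℕ → K → Prop
  | 0, F, A, c => F A = c
  | k + 1, F, A, c => ∀ᶠ a in (U : Filter ℕ), UltraLim U k F (insert a A) c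

theorem exists_ultraLim {K : Type} [Finite K] (U : Ultrafilter ℕ) (F : Finset ℕ → K) (k : ℕ) :
    ∀ A, ∃ c, UltraLim U k F A c := by
  induction k with
  | zero => exact fun A => ⟨F A, rfl⟩
  | succ k ih =>
    intro A
    choose f hf using fun a => ih (insert a A)
    obtain ⟨c, hc⟩ := (Ultrafilter.eventually_exists_iff (f := U)
      (P := fun c a => f a = c)).1 (Filter.Eventually.of_forall fun a => ⟨f a, rfl⟩)
    refine ⟨c, ?_⟩
    filter_upwards [hc] with a ha
    exact ha ▸ hf a

/-- Finite Ramsey theorem for hypergraphs. -/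
theorem exists_homogeneous_finset {K : Type} [Finite K] (k M : ℕ) (F : Finset ℕ → K) :
    ∃ (c : K) (H : Finset ℕ), H.card = M ∧ ∀ A ⊆ H, A.card = k → F A = c := by
  let U : Ultrafilter ℕ := Filter.hyperfilter ℕ
  obtain ⟨c, hc⟩ := exists_ultraLim U F k ∅
  suffices h : ∃ H : Finset ℕ, H.card = M ∧
      ∀ A ⊆ H, A.card ≤ k → UltraLim U (k - A.card) F A c by
    obtain ⟨H, hH, h⟩ := h
    refine ⟨c, H, hH, fun A hA hk => ?_⟩
    have := h A hA hk.le
    rwa [hk, Nat.sub_self] at this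
  induction M with
  | zero =>
    refine ⟨∅, rfl, fun A hA _ => ?_⟩
    obtain rfl := Finset.subset_empty.1 hA
    simpa using hc
  | succ M ih =>
    obtain ⟨H, hH, h⟩ := ih
    have h1 : ∀ᶠ a in (U : Filter ℕ), a ∉ H := by
      have : (H : Set ℕ)ᶜ ∈ Filter.hyperfilter ℕ :=
        Filter.compl_mem_hyperfilter_of_finite H.finite_toSet
      filter_upwards [this] with a ha
      simpa using ha
    have h2 : ∀ᶠ a in (U : Filter ℕ), ∀ A ∈ H.powerset, A.card < k →
        UltraLim U (k - (A.card + 1)) F (insert a A) c := by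
      rw [Filter.eventually_all_finset]
      intro A hA
      by_cases hk : A.card < k
      · have := h A (Finset.mem_powerset.1 hA) hk.le
        obtain ⟨m, hm⟩ : ∃ m, k - A.card = m + 1 := ⟨k - A.card - 1, by omega⟩
        rw [hm] at this
        have hm' : k - (A.card + 1) = m := by omega
        rw [hm']
        filter_upwards [this] with a ha _
        exact ha
      · exact Filter.Eventually.of_forall fun a h => absurd h hk
    obtain ⟨a, ha, ha'⟩ := (h1.and h2).exists
    refine ⟨insert a H, by rw [Finset.card_insert_of_notMem ha, hH], fun A hA hk => ?_⟩
    by_cases haA : a ∈ A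
    · have hB : A.erase a ⊆ H := by
        rw [Finset.subset_insert_iff] at hA
        exact hA
      have hcard := Finset.card_erase_add_one haA
      have := ha' _ (Finset.mem_powerset.2 hB) (by omega)
      rwa [hcard, Finset.insert_erase haA] at this
    · exact h A ((Finset.subset_insert_iff_of_notMem haA).1 hA) hk

/-- Finite Ramsey theorem for increasing tuples. -/
theorem exists_homogeneous_tuples {K : Type} [Finite K] [Nonempty K] (k M : ℕ)
    (F : (Fin k → ℕ) → K) :
    ∃ (c : K) (φ : Fin M → ℕ), StrictMono φ ∧
      ∀ s : Fin k → Fin M, StrictMono s → F (φ ∘ s) = c := by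
  classical
  obtain ⟨c, H, hH, h⟩ := exists_homogeneous_finset k M
    (fun A => if hA : A.card = k then F (A.orderEmbOfFin hA) else Classical.arbitrary K)
  refine ⟨c, H.orderEmbOfFin hH, (H.orderEmbOfFin hH).strictMono, fun s hs => ?_⟩
  have hmono : StrictMono (H.orderEmbOfFin hH ∘ s) := (H.orderEmbOfFin hH).strictMono.comp hs
  have hcard : (Finset.univ.image (H.orderEmbOfFin hH ∘ s)).card = k := by
    rw [Finset.card_image_of_injective _ hmono.injective, Finset.card_univ, Fintype.card_fin]
  have := h (Finset.univ.image (H.orderEmbOfFin hH ∘ s)) (by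
    intro x hx
    obtain ⟨i, -, rfl⟩ := Finset.mem_image.1 hx
    exact Finset.orderEmbOfFin_mem _ _ _) hcard
  rw [dif_pos hcard] at this
  rw [← this]
  congr 1
  exact Finset.orderEmbOfFin_unique hcard (fun i => Finset.mem_image_of_mem _ (Finset.mem_univ _))
    hmono

/-- In high dimension, any colouring of the subsets of the index set is determined, on the unions
of suitable disjoint nonempty blocks, by the least block that occurs. -/
theorem exists_blocks_min_determined (K : Type) [Finite K] (m : ℕ) :
    ∃ N : ℕ, ∀ col : (Fin N → Bool) → K, ∃ (τ : Fin N → Option (Fin m)) (k : Fin m → K),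
      (∀ b, ∃ i, τ i = some b) ∧
      ∀ (T : Fin m → Bool) (b : Fin m), T b = true → (∀ b' < b, T b' = false) →
        col (fun i => (τ i).elim false T) = k b := by
  induction m with
  | zero => exact ⟨0, fun col => ⟨fun _ => none, fun b => b.elim0, fun b => b.elim0,
      fun T b => b.elim0⟩⟩
  | succ m ih =>
    obtain ⟨N', hN'⟩ := ih
    obtain ⟨ι, _, hι⟩ := Combinatorics.Subspace.exists_mono_in_high_dimension
      Bool K (Option (Fin N'))
    let e := Fintype.equivFin ι
    refine ⟨Fintype.card ι, fun col => ?_⟩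
    obtain ⟨l, c, hl⟩ := hι fun w => col (w ∘ e.symm)
    obtain ⟨τ, k, hτ, hk⟩ := hN' fun S => col fun i =>
      (l.idxFun (e.symm i)).elim (fun _ => false) (fun o => o.elim false S)
    refine ⟨fun i => (l.idxFun (e.symm i)).elim (fun b => if b then some 0 else none)
      (fun o => o.elim (some 0) (fun j => (τ j).map Fin.succ)), Fin.cons c k, ?_, ?_⟩
    · intro b
      induction b using Fin.cases with
      | zero =>
        obtain ⟨i, hi⟩ := l.proper none
        exact ⟨e i, by simp [hi]⟩
      | succ b =>
        obtain ⟨j, hj⟩ := hτ b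
        obtain ⟨i, hi⟩ := l.proper (some j)
        exact ⟨e i, by simp [hi, hj]⟩
    · intro T b hb hb'
      induction b using Fin.cases with
      | zero =>
        rw [Fin.cons_zero, ← hl fun o => o.elim true fun j => (τ j).elim false (T ∘ Fin.succ)]
        congr 1
        funext i
        simp only [Function.comp, Combinatorics.Subspace.apply_def]
        rcases l.idxFun (e.symm i) with b | (_ | j)
        · cases b <;> simp [hb]
        · simp [hb]
        · rcases h : τ j <;> simp [h]
      | succ b =>
        have h0 : T 0 = false := hb' 0 (Fin.succ_pos b)
        rw [Fin.cons_succ, ← hk (T ∘ Fin.succ) b hb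
          fun b' h => hb' _ (Fin.succ_lt_succ_iff.2 h)]
        congr 1
        funext i
        rcases hl : l.idxFun (e.symm i) with b | (_ | j)
        · cases b <;> simp [hl, h0]
        · simp [hl, h0]
        · rcases hτ : τ j <;> simp [hl, hτ]

/-- Finite unions theorem, for disjoint nonempty blocks indexed by `B`. -/
theorem exists_blocks_constant (K B : Type) [Finite K] [Finite B] :
    ∃ N : ℕ, ∀ col : (Fin N → Bool) → K, ∃ (τ : Fin N → Option B) (k : K),
      (∀ b, ∃ i, τ i = some b) ∧
      ∀ T : B → Bool, (∃ b, T b = true) → col (fun i => (τ i).elim false T) = k := by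
  classical
  have := Fintype.ofFinite K
  have := Fintype.ofFinite B
  obtain ⟨N, hN⟩ := exists_blocks_min_determined K (Fintype.card K * Fintype.card B + 1)
  refine ⟨N, fun col => ?_⟩
  obtain ⟨τ, k, hτ, hk⟩ := hN col
  obtain ⟨c, hc⟩ := Fintype.exists_lt_card_fiber_of_mul_lt_card (f := k) (n := Fintype.card B)
    (by simp)
  obtain ⟨g⟩ : Nonempty (B ↪ {x // x ∈ Finset.univ.filter fun x => k x = c}) := by
    apply Function.Embedding.nonempty_of_card_le
    rw [Fintype.card_coe]
    exact hc.le
  have hg : ∀ b, k (g b) = c := fun b => (Finset.mem_filter.1 (g b).2).2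
  have hinj : Function.Injective fun b => (g b).1 := fun _ _ h =>
    g.injective (Subtype.val_injective h)
  refine ⟨fun i => (τ i).bind fun j => if h : ∃ b, (g b).1 = j then some h.choose else none,
    c, ?_, ?_⟩
  · intro b
    obtain ⟨i, hi⟩ := hτ (g b)
    refine ⟨i, ?_⟩
    have h : ∃ b', (g b').1 = g b := ⟨b, rfl⟩
    simp only [hi, Option.bind_some, dif_pos h, Option.some.injEq]
    exact hinj h.choose_spec
  · rintro T ⟨b, hb⟩
    let T' : Fin (Fintype.card K * Fintype.card B + 1) → Bool :=
      fun j => if h : ∃ b, (g b).1 = j then T h.choose else false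
    have hT' : ∀ b, T' (g b) = T b := by
      intro b
      have h : ∃ b', (g b').1 = g b := ⟨b, rfl⟩
      simp only [T', dif_pos h]
      exact congrArg T (hinj h.choose_spec)
    have hne : (Finset.univ.filter fun j => T' j = true).Nonempty :=
      ⟨g b, by simp [hT', hb]⟩
    obtain ⟨j, hj, hmin⟩ := Finset.exists_min_image _ id hne
    have hj' : T' j = true := (Finset.mem_filter.1 hj).2
    have hjg : ∃ b, (g b).1 = j := by
      by_contra h
      simp [T', h] at hj'
    obtain ⟨b₀, rfl⟩ := hjg
    refine Eq.trans ?_ ((hk T' (g b₀).1 hj' fun b' hb' => ?_).trans (hg b₀))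
    · congr 1
      funext i
      rcases h : τ i with _ | j
      · simp [h]
      · by_cases hj : ∃ b, (g b).1 = j <;> simp [T', h, hj]
    · by_contra h
      have := hmin b' (by simpa using h)
      exact absurd hb' (not_lt.2 this)

/-- The code of a pair of elements of a partial order: `1` for `<`, `-1` for `>`, and `0`
otherwise. -/
noncomputable def ordCode (x y : P) : ZMod 3 :=
  open Classical in if x < y then 1 else if y < x then -1 else 0

theorem ordCode_eq_one {x y : P} : ordCode x y = 1 ↔ x < y := by
  unfold ordCode
  split_ifs with h h'
  · exact iff_of_true rfl h
  · exact iff_of_false (by decide) h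
  · exact iff_of_false (by decide) h

theorem ordCode_eq_neg_one {x y : P} : ordCode x y = -1 ↔ y < x := by
  unfold ordCode
  split_ifs with h h'
  · exact iff_of_false (by decide) h.asymm
  · exact iff_of_true rfl h'
  · exact iff_of_false (by decide) h'

theorem ordCode_self (x : P) : ordCode x x = 0 := by simp [ordCode]

theorem ordCode_swap (x y : P) : ordCode y x = -ordCode x y := by
  by_cases h : x < y
  · rw [ordCode_eq_one.2 h, ordCode_eq_neg_one.2 h]
  by_cases h' : y < x
  · rw [ordCode_eq_one.2 h', ordCode_eq_neg_one.2 h', neg_neg]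
  · simp [ordCode, h, h']

theorem ZMod3_cases (x : ZMod 3) : x = 0 ∨ x = 1 ∨ x = -1 := by
  revert x; decide

theorem ordCode_eq_zero {x y : P} (h : x ≠ y) : ordCode x y = 0 ↔ Perp x y := by
  unfold ordCode Perp
  split_ifs with h1 h2
  · exact iff_of_false (by decide) fun h => h.1 h1.le
  · exact iff_of_false (by decide) fun h => h.2 h2.le
  · rw [lt_iff_le_and_ne] at h1 h2
    exact iff_of_true rfl ⟨fun h' => h1 ⟨h', h⟩, fun h' => h2 ⟨h', fun h' => h h'.symm⟩⟩

theorem eq_of_eq_one_iff {x y : ZMod 3} (h : x = 1 ↔ y = 1) (h' : -x = 1 ↔ -y = 1) : x = y := by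
  revert x y; decide

theorem ordCode_eq_iff {Q : Type} [PartialOrder Q] {x y : P} {x' y' : Q} :
    ordCode x y = ordCode x' y' ↔ (x < y ↔ x' < y') ∧ (y < x ↔ y' < x') := by
  refine ⟨fun h => ?_, fun h => ?_⟩
  · constructor
    · rw [← ordCode_eq_one, h, ordCode_eq_one]
    · rw [← ordCode_eq_neg_one, h, ordCode_eq_neg_one]
  · apply eq_of_eq_one_iff
    · rw [ordCode_eq_one, ordCode_eq_one, h.1]
    · rw [← ordCode_swap, ← ordCode_swap, ordCode_eq_one, ordCode_eq_one, h.2]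

/-- `κ` is the code of a strict partial order. -/
structure IsPosCode {I : Type} (κ : I → I → ZMod 3) : Prop where
  self : ∀ i, κ i i = 0
  swap : ∀ i j, κ j i = -κ i j
  trans : ∀ i j k, κ i j = 1 → κ j k = 1 → κ i k = 1

theorem isPosCode_ordCode : IsPosCode (ordCode (P := P)) where
  self := ordCode_self
  swap := ordCode_swap
  trans _ _ _ h h' := ordCode_eq_one.2 ((ordCode_eq_one.1 h).trans (ordCode_eq_one.1 h'))

theorem IsPosCode.comap {I J : Type} {κ : I → I → ZMod 3} (h : IsPosCode κ) (f : J → I) :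
    IsPosCode fun i j => κ (f i) (f j) :=
  ⟨fun _ => h.self _, fun _ _ => h.swap _ _, fun _ _ _ => h.trans _ _ _⟩

/-- The code of `z` over `x` and `y` can be `s` and `t` if the code of `x` and `y` is `w`. -/
def ValidType (w s t : ZMod 3) : Prop :=
  (w = 1 → t = 1 → s = 1) ∧ (w = 1 → s = -1 → t = -1) ∧ (s = 1 → t = -1 → w = 1)

instance (w s t : ZMod 3) : Decidable (ValidType w s t) := by
  unfold ValidType; infer_instance

/-- Every valid finite type over the code `w` is realized. -/
def HasExt {A : Type} (w : A → A → ZMod 3) : Prop :=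
  ∀ (F : Finset A) (t : A → ZMod 3), (∀ x ∈ F, ∀ y ∈ F, ValidType (w x y) (t x) (t y)) →
    ∃ z ∉ F, ∀ x ∈ F, w x z = t x

theorem IsPosCode.validType {I : Type} {κ : I → I → ZMod 3} (h : IsPosCode κ) (x y z : I) :
    ValidType (κ x y) (κ x z) (κ y z) := by
  refine ⟨h.trans _ _ _, fun h1 h2 => ?_, fun h1 h2 => ?_⟩
  · have h3 : κ z x = 1 := by rw [h.swap x z, h2, neg_neg]
    rw [h.swap z y, h.trans _ _ _ h3 h1]
  · have h3 : κ z y = 1 := by rw [h.swap y z, h2, neg_neg]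
    exact h.trans _ _ _ h1 h3

/-- A finite set of pairs that is an isomorphism between finite parts of two codes. -/
abbrev PartialCodeIso {A B : Type} (w : A → A → ZMod 3) (w' : B → B → ZMod 3) : Type :=
  {f : Finset (A × B) // ∀ p ∈ f, ∀ q ∈ f, (p.1 = q.1 ↔ p.2 = q.2) ∧ w p.1 q.1 = w' p.2 q.2}

namespace PartialCodeIso

variable {A B : Type} {w : A → A → ZMod 3} {w' : B → B → ZMod 3}

instance : Inhabited (PartialCodeIso w w') := ⟨⟨∅, by simp⟩⟩

/-- The inverse of a partial isomorphism. -/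
def symm (f : PartialCodeIso w w') : PartialCodeIso w' w :=
  ⟨f.1.map (Equiv.prodComm A B).toEmbedding, by
    intro p hp q hq
    rw [Finset.mem_map_equiv] at hp hq
    have := f.2 _ hp _ hq
    exact ⟨this.1.symm, this.2.symm⟩⟩

theorem mem_symm {f : PartialCodeIso w w'} {p : B × A} : p ∈ f.symm.1 ↔ (p.2, p.1) ∈ f.1 := by
  unfold symm
  rw [Finset.mem_map_equiv]
  rfl

theorem exists_le_left (hw : IsPosCode w) (hw' : IsPosCode w') (hE : HasExt w')
    (f : PartialCodeIso w w') (a : A) :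
    ∃ g : PartialCodeIso w w', f ≤ g ∧ ∃ b, (a, b) ∈ g.1 := by
  classical
  by_cases ha : ∃ b, (a, b) ∈ f.1
  · exact ⟨f, le_rfl, ha⟩
  let t : B → ZMod 3 := fun b => if h : ∃ x, (x, b) ∈ f.1 then w h.choose a else 0
  have ht : ∀ x b, (x, b) ∈ f.1 → t b = w x a := by
    intro x b h
    have h' : ∃ x, (x, b) ∈ f.1 := ⟨x, h⟩
    simp only [t, dif_pos h']
    rw [show h'.choose = x from (f.2 _ h'.choose_spec _ h).1.2 rfl]
  obtain ⟨z, hz, hz'⟩ := hE (f.1.image Prod.snd) t (by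
    intro x hx y hy
    obtain ⟨p, hp, rfl⟩ := Finset.mem_image.1 hx
    obtain ⟨q, hq, rfl⟩ := Finset.mem_image.1 hy
    rw [ht _ _ hp, ht _ _ hq, ← (f.2 _ hp _ hq).2]
    exact hw.validType _ _ _)
  have key : ∀ x b, (x, b) ∈ f.1 → x ≠ a ∧ b ≠ z ∧ w x a = w' b z := by
    intro x b h
    have hb : b ∈ f.1.image Prod.snd := Finset.mem_image.2 ⟨_, h, rfl⟩
    refine ⟨?_, ?_, ?_⟩
    · rintro rfl
      exact ha ⟨_, h⟩
    · rintro rfl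
      exact hz hb
    · rw [hz' b hb, ht _ _ h]
  refine ⟨⟨insert (a, z) f.1, ?_⟩, ?_, z, Finset.mem_insert_self _ _⟩
  · intro p hp q hq
    rcases Finset.mem_insert.1 hp with rfl | hp <;> rcases Finset.mem_insert.1 hq with rfl | hq
    · simp [hw.self, hw'.self]
    · obtain ⟨h1, h2, h3⟩ := key q.1 q.2 hq
      refine ⟨by simp [h1.symm, h2.symm], ?_⟩
      rw [hw.swap q.1, hw'.swap q.2, h3]
    · obtain ⟨h1, h2, h3⟩ := key p.1 p.2 hp
      exact ⟨by simp [h1, h2], h3⟩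
    · exact f.2 _ hp _ hq
  · exact Finset.subset_insert _ _

theorem exists_le_right (hw : IsPosCode w) (hw' : IsPosCode w') (hE : HasExt w)
    (f : PartialCodeIso w w') (b : B) :
    ∃ g : PartialCodeIso w w', f ≤ g ∧ ∃ a, (a, b) ∈ g.1 := by
  obtain ⟨g, hg, a, ha⟩ := exists_le_left hw' hw hE f.symm b
  refine ⟨g.symm, fun p hp => mem_symm.2 (hg (mem_symm.2 hp)), a, mem_symm.2 ha⟩

/-- Partial isomorphisms defined at `a`. -/
def definedAtLeft (hw : IsPosCode w) (hw' : IsPosCode w') (hE : HasExt w') (a : A) :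
    Order.Cofinal (PartialCodeIso w w') where
  carrier := {f | ∃ b, (a, b) ∈ f.1}
  isCofinal f := by
    obtain ⟨g, hg, h⟩ := exists_le_left hw hw' hE f a
    exact ⟨g, h, hg⟩

/-- Partial isomorphisms whose range contains `b`. -/
def definedAtRight (hw : IsPosCode w) (hw' : IsPosCode w') (hE : HasExt w) (b : B) :
    Order.Cofinal (PartialCodeIso w w') where
  carrier := {f | ∃ a, (a, b) ∈ f.1}
  isCofinal f := by
    obtain ⟨g, hg, h⟩ := exists_le_right hw hw' hE f b
    exact ⟨g, h, hg⟩

end PartialCodeIso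

open PartialCodeIso in
/-- A countable code embeds in a code with the extension property. -/
theorem exists_embedding_of_hasExt {A B : Type} [Countable A] {w : A → A → ZMod 3}
    {w' : B → B → ZMod 3} (hw : IsPosCode w) (hw' : IsPosCode w') (hE : HasExt w') :
    ∃ f : A → B, Function.Injective f ∧ ∀ x y, w' (f x) (f y) = w x y := by
  have := Encodable.ofCountable A
  let I := Order.idealOfCofinals (default : PartialCodeIso w w') (definedAtLeft hw hw' hE)
  choose m hm hmI using fun a =>
    Order.cofinal_meets_idealOfCofinals default (definedAtLeft hw hw' hE) a
  choose f hf using hm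
  have key : ∀ x y, (x = y ↔ f x = f y) ∧ w x y = w' (f x) (f y) := by
    intro x y
    obtain ⟨h, -, hx, hy⟩ := I.directed _ (hmI x) _ (hmI y)
    exact h.2 _ (hx (hf x)) _ (hy (hf y))
  exact ⟨f, fun x y h => (key x y).1.2 h, fun x y => (key x y).2.symm⟩

open PartialCodeIso in
/-- Countable codes with the extension property are isomorphic. -/
theorem exists_equiv_of_hasExt {A B : Type} [Countable A] [Countable B] {w : A → A → ZMod 3}
    {w' : B → B → ZMod 3} (hw : IsPosCode w) (hw' : IsPosCode w') (hE : HasExt w)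
    (hE' : HasExt w') : ∃ f : A ≃ B, ∀ x y, w' (f x) (f y) = w x y := by
  have := Encodable.ofCountable A
  have := Encodable.ofCountable B
  let C : A ⊕ B → Order.Cofinal (PartialCodeIso w w') := fun p =>
    Sum.recOn p (definedAtLeft hw hw' hE') (definedAtRight hw hw' hE)
  let I := Order.idealOfCofinals default C
  choose m hm hmI using fun a => Order.cofinal_meets_idealOfCofinals default C (Sum.inl a)
  choose n hn hnI using fun b => Order.cofinal_meets_idealOfCofinals default C (Sum.inr b)
  choose f hf using hm
  choose g hg using hn
  have key : ∀ p q : A × B, (∃ h ∈ I, p ∈ h.1) → (∃ h ∈ I, q ∈ h.1) →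
      (p.1 = q.1 ↔ p.2 = q.2) ∧ w p.1 q.1 = w' p.2 q.2 := by
    rintro p q ⟨h, hI, hp⟩ ⟨h', hI', hq⟩
    obtain ⟨k, -, hk, hk'⟩ := I.directed _ hI _ hI'
    exact k.2 _ (hk hp) _ (hk' hq)
  refine ⟨⟨f, g, fun a => ?_, fun b => ?_⟩, fun x y => ?_⟩
  · exact (key (g (f a), f a) (a, f a) ⟨_, hnI _, hg _⟩ ⟨_, hmI _, hf _⟩).1.2 rfl
  · exact (key (g b, f (g b)) (g b, b) ⟨_, hmI _, hf _⟩ ⟨_, hnI _, hg _⟩).1.1 rfl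
  · exact (key (x, f x) (y, f y) ⟨_, hmI _, hf _⟩ ⟨_, hmI _, hf _⟩).2.symm

/-- The partial order with a given code. -/
@[reducible] def IsPosCode.toPartialOrder {I : Type} {κ : I → I → ZMod 3} (h : IsPosCode κ) :
    PartialOrder I where
  le i j := i = j ∨ κ i j = 1
  le_refl i := Or.inl rfl
  le_trans i j k := by
    rintro (rfl | h1) (rfl | h2)
    · exact Or.inl rfl
    · exact Or.inr h2
    · exact Or.inr h1
    · exact Or.inr (h.trans _ _ _ h1 h2)
  le_antisymm i j := by
    rintro (rfl | h1) (h2 | h2)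
    · rfl
    · rfl
    · exact h2.symm
    · rw [h.swap i j, h1] at h2
      exact absurd h2 (by decide)

theorem exists_ordCode_eq (hU : IsUniversal P) {I : Type} [Finite I] {κ : I → I → ZMod 3}
    (h : IsPosCode κ) :
    ∃ a : I → P, Function.Injective a ∧ ∀ i j, ordCode (a i) (a j) = κ i j := by
  have := Fintype.ofFinite I
  obtain ⟨e⟩ := @hU I h.toPartialOrder _
  have key : ∀ i j, ordCode (e i) (e j) = 1 ↔ κ i j = 1 := by
    intro i j
    rw [ordCode_eq_one]
    have h1 : e i ≤ e j ↔ i = j ∨ κ i j = 1 := e.map_rel_iff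
    rw [lt_iff_le_and_ne, h1, Ne, e.injective.eq_iff]
    constructor
    · rintro ⟨h1 | h1, h2⟩
      · exact absurd h1 h2
      · exact h1
    · intro h1
      refine ⟨Or.inr h1, ?_⟩
      rintro rfl
      rw [h.self] at h1
      exact absurd h1 (by decide)
  refine ⟨e, e.injective, fun i j => eq_of_eq_one_iff (key i j) ?_⟩
  rw [← ordCode_swap, ← h.swap]
  exact key j i

theorem exists_orderIso_of_ordCode_eq (hH : IsHomogeneous P) {I : Type} [Finite I] {a b : I → P}
    (ha : Function.Injective a) (hb : Function.Injective b)
    (h : ∀ i j, ordCode (a i) (a j) = ordCode (b i) (b j)) :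
    ∃ g : P ≃o P, ∀ i, g (a i) = b i := by
  classical
  have := Fintype.ofFinite I
  have hle : ∀ i j, b i ≤ b j ↔ a i ≤ a j := by
    intro i j
    rw [le_iff_lt_or_eq, le_iff_lt_or_eq, ← ordCode_eq_one, ← ordCode_eq_one, h, ha.eq_iff,
      hb.eq_iff]
  have ea : ∀ x : ((Finset.univ.image a : Finset P) : Set P), ∃ i, a i = x := fun x => by
    simpa using x.2
  choose u hu using ea
  have eb : ∀ x : ((Finset.univ.image b : Finset P) : Set P), ∃ i, b i = x := fun x => by
    simpa using x.2
  choose v hv using eb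
  have hua : ∀ i p, u ⟨a i, p⟩ = i := fun i p => ha (hu _)
  have hvb : ∀ i p, v ⟨b i, p⟩ = i := fun i p => hb (hv _)
  obtain ⟨g, hg⟩ := hH (Finset.univ.image a) (Finset.univ.image b)
    { toFun := fun x => ⟨b (u x), by simp⟩
      invFun := fun x => ⟨a (v x), by simp⟩
      left_inv := fun x => Subtype.ext (by simp only [hvb, hu])
      right_inv := fun x => Subtype.ext (by simp only [hua, hv])
      map_rel_iff' := by
        intro x y
        change b (u x) ≤ b (u y) ↔ (x : P) ≤ y
        rw [hle, hu, hu] }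
  refine ⟨g, fun i => ?_⟩
  have := hg ⟨a i, by simp⟩
  simpa [hua] using this

/-- The code of a point added to a code. -/
def optionCode {I : Type} (w : I → I → ZMod 3) (t : I → ZMod 3) : Option I → Option I → ZMod 3
  | some i, some j => w i j
  | some i, none => t i
  | none, some j => -t j
  | none, none => 0

theorem isPosCode_optionCode {I : Type} {w : I → I → ZMod 3} {t : I → ZMod 3} (h : IsPosCode w)
    (ht : ∀ i j, ValidType (w i j) (t i) (t j)) : IsPosCode (optionCode w t) where
  self i := by cases i <;> simp [optionCode, h.self]
  swap i j := by rcases i with _ | i <;> rcases j with _ | j <;> simp [optionCode, ← h.swap]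
  trans i j k := by
    rcases i with _ | i <;> rcases j with _ | j <;> rcases k with _ | k <;>
      simp only [optionCode]
    · decide
    · exact fun h => absurd h (by decide)
    · exact fun h1 h2 => absurd (h1.symm.trans (neg_eq_iff_eq_neg.1 (h1.trans h2.symm)).symm) (by
        intro h3; rw [h2] at h1; exact absurd h1 (by decide))
    · intro h1 h2
      have := (ht j k).2.1 h2 (by rw [← h1, neg_neg])
      rw [this, neg_neg]
    · exact fun _ h => absurd h (by decide)
    · intro h1 h2
      exact (ht i k).2.2 h1 (by rw [← h2, neg_neg])
    · exact fun h1 h2 => (ht i j).1 h1 h2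
    · exact h.trans _ _ _

theorem hasExt_ordCode (hU : IsUniversal P) (hH : IsHomogeneous P) :
    HasExt (ordCode (P := P)) := by
  intro F t ht
  obtain ⟨a, ha, ha'⟩ := exists_ordCode_eq hU (isPosCode_optionCode
    (isPosCode_ordCode.comap (fun x : F => x.1)) (t := fun x : F => t x)
    fun i j => ht _ i.2 _ j.2)
  obtain ⟨g, hg⟩ := exists_orderIso_of_ordCode_eq hH (a := fun x : F => a (some x))
    (b := fun x : F => x.1) (fun x y h => by simpa using ha h) Subtype.val_injective
    fun i j => ha' _ _
  refine ⟨g (a none), fun h => ?_, fun x hx => ?_⟩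
  · have := hg ⟨_, h⟩
    exact absurd (ha (g.injective this)) (by simp)
  · have h1 : ordCode (a (some ⟨x, hx⟩)) (a none) = t x := ha' _ _
    have h2 : ∀ y z, ordCode (g y) (g z) = ordCode y z := fun y z =>
      ordCode_eq_iff.2 ⟨g.lt_iff_lt, g.lt_iff_lt⟩
    rw [← h1, ← h2 (a (some ⟨x, hx⟩)), hg]

/-- The code rotated so that `p` becomes incomparable to everything. -/
def rotCode {I : Type} (κ : I → I → ZMod 3) (p x y : I) : ZMod 3 := κ p x + κ x y - κ p y

/-- All the constraints that transitivity puts on the code of three points `x`, `y`, `z`. -/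
def ValidTriple (xy xz yz : ZMod 3) : Prop := ValidType xy xz yz ∧ ValidType (-xy) yz xz

instance (w s t : ZMod 3) : Decidable (ValidTriple w s t) := by
  unfold ValidTriple; infer_instance

theorem IsPosCode.validTriple {I : Type} {κ : I → I → ZMod 3} (h : IsPosCode κ) (x y z : I) :
    ValidTriple (κ x y) (κ x z) (κ y z) :=
  ⟨h.validType _ _ _, by rw [← h.swap]; exact h.validType _ _ _⟩

theorem rot_trans_aux : ∀ px py xy : ZMod 3, ValidTriple px py xy →
    ∀ pz yz, ValidTriple py pz yz → ∀ xz, ValidTriple px pz xz → ValidTriple xy xz yz →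
      px + xy - py = 1 → py + yz - pz = 1 → px + xz - pz = 1 := by
  decide +kernel

theorem IsPosCode.rotCode {I : Type} {κ : I → I → ZMod 3} (h : IsPosCode κ) (p : I) :
    IsPosCode (rotCode κ p) where
  self x := by simp [_root_.rotCode, h.self]
  swap x y := by simp only [_root_.rotCode, h.swap x y]; ring
  trans x y z := rot_trans_aux _ _ _ (h.validTriple p x y) _ _ (h.validTriple p y z) _
    (h.validTriple p x z) (h.validTriple x y z)

set_option synthInstance.maxSize 2000 in
set_option synthInstance.maxHeartbeats 200000 in
theorem rot_ext_aux_neg : ∀ px xy py : ZMod 3, ValidTriple px py xy →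
    ∀ tx ty, ValidTriple (px + xy - py) tx ty →
    ∀ ux, ValidTriple ux 1 (-px) → ValidTriple (-1 + ux - px) 1 tx →
    ∀ uy, ValidTriple uy 1 (-py) → ValidTriple ux uy xy → ValidTriple (-1 + uy - py) 1 ty →
      ValidType xy (tx - px + -1) (ty - py + -1) := by
  decide +kernel

set_option synthInstance.maxSize 2000 in
set_option synthInstance.maxHeartbeats 200000 in
theorem rot_ext_aux_pos : ∀ px xy py : ZMod 3, ValidTriple px py xy →
    ∀ tx ty, ValidTriple (px + xy - py) tx ty →
    ∀ ux, ValidTriple ux (-1) (-px) → ValidTriple (1 + ux - px) (-1) tx →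
    ∀ uy, ValidTriple uy (-1) (-py) → ValidTriple ux uy xy → ValidTriple (1 + uy - py) (-1) ty →
      ValidType xy (tx - px + 1) (ty - py + 1) := by
  decide +kernel

set_option synthInstance.maxSize 2000 in
set_option synthInstance.maxHeartbeats 200000 in
theorem rot_ext_aux_zero : ∀ px xy py : ZMod 3, ValidTriple px py xy →
    ∀ tx ty, ValidTriple (px + xy - py) tx ty →
    ¬ (px = -1 ∧ tx = 1) → ¬ (px = 1 ∧ tx = -1) → ¬ (py = -1 ∧ ty = 1) → ¬ (py = 1 ∧ ty = -1) →
      ValidType xy (tx - px) (ty - py) := by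
  decide +kernel

theorem exists_shift_validType {I : Type} {κ : I → I → ZMod 3} (h : IsPosCode κ) (p : I)
    (F : Finset I) (t : I → ZMod 3)
    (ht : ∀ x ∈ F, ∀ y ∈ F, ValidType (rotCode κ p x y) (t x) (t y)) :
    ∃ u, ∀ x ∈ F, ∀ y ∈ F, ValidType (κ x y) (t x - κ p x + u) (t y - κ p y + u) := by
  have ht' : ∀ x ∈ F, ∀ y ∈ F, ValidTriple (κ p x + κ x y - κ p y) (t x) (t y) := by
    intro x hx y hy
    refine ⟨ht x hx y hy, ?_⟩
    have := ht y hy x hx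
    rwa [(h.rotCode p).swap x y] at this
  by_cases h1 : ∃ x ∈ F, κ p x = -1 ∧ t x = 1
  · obtain ⟨a, ha, hpa, hta⟩ := h1
    have hap : κ a p = 1 := by rw [h.swap p a, hpa, neg_neg]
    have k1 : ∀ x, ValidTriple (κ a x) 1 (-κ p x) := fun x => by
      have := h.validTriple a x p
      rwa [hap, h.swap p x] at this
    have k2 : ∀ x ∈ F, ValidTriple (-1 + κ a x - κ p x) 1 (t x) := fun x hx => by
      have := ht' a ha x hx
      rwa [hpa, hta] at this
    exact ⟨-1, fun x hx y hy => rot_ext_aux_neg _ _ _ (h.validTriple p x y) _ _ (ht' x hx y hy) _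
      (k1 x) (k2 x hx) _ (k1 y) (h.validTriple a x y) (k2 y hy)⟩
  by_cases h2 : ∃ x ∈ F, κ p x = 1 ∧ t x = -1
  · obtain ⟨a, ha, hpa, hta⟩ := h2
    have hap : κ a p = -1 := by rw [h.swap p a, hpa]
    have k1 : ∀ x, ValidTriple (κ a x) (-1) (-κ p x) := fun x => by
      have := h.validTriple a x p
      rwa [hap, h.swap p x] at this
    have k2 : ∀ x ∈ F, ValidTriple (1 + κ a x - κ p x) (-1) (t x) := fun x hx => by
      have := ht' a ha x hx
      rwa [hpa, hta] at this
    exact ⟨1, fun x hx y hy => rot_ext_aux_pos _ _ _ (h.validTriple p x y) _ _ (ht' x hx y hy) _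
      (k1 x) (k2 x hx) _ (k1 y) (h.validTriple a x y) (k2 y hy)⟩
  push Not at h1 h2
  refine ⟨0, fun x hx y hy => ?_⟩
  rw [add_zero, add_zero]
  exact rot_ext_aux_zero _ _ _ (h.validTriple p x y) _ _ (ht' x hx y hy)
    (fun h => h1 x hx h.1 h.2) (fun h => h2 x hx h.1 h.2) (fun h => h1 y hy h.1 h.2)
    (fun h => h2 y hy h.1 h.2)

theorem HasExt.subtype_ne {I : Type} {κ : I → I → ZMod 3} (hE : HasExt κ) (h : IsPosCode κ)
    (p : I) : HasExt fun x y : {x // x ≠ p} => κ x y := by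
  classical
  intro F t ht
  have ht' : ∀ x ∈ F, ∀ y ∈ F, ValidTriple (κ x y) (t x) (t y) := by
    refine fun x hx y hy => ⟨ht x hx y hy, ?_⟩
    rw [← h.swap]
    exact ht y hy x hx
  have hp : ∃ u, ∀ x ∈ F, ValidTriple (κ p x) u (t x) := by
    by_cases h1 : ∃ a ∈ F, κ p a = 1 ∧ t a = 1
    · obtain ⟨a, ha, hpa, hta⟩ := h1
      refine ⟨1, fun x hx => ?_⟩
      have k1 := h.validTriple p a x
      have k2 := ht' a ha x hx
      rw [hpa] at k1
      rw [hta] at k2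
      revert k1 k2
      generalize κ p x = c; generalize t x = d; generalize κ a x = e
      revert c d e; decide
    by_cases h2 : ∃ a ∈ F, κ p a = -1 ∧ t a = -1
    · obtain ⟨a, ha, hpa, hta⟩ := h2
      refine ⟨-1, fun x hx => ?_⟩
      have k1 := h.validTriple p a x
      have k2 := ht' a ha x hx
      rw [hpa] at k1
      rw [hta] at k2
      revert k1 k2
      generalize κ p x = c; generalize t x = d; generalize κ a x = e
      revert c d e; decide
    push Not at h1 h2
    refine ⟨0, fun x hx => ?_⟩
    have k1 := h1 x hx
    have k2 := h2 x hx
    revert k1 k2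
    generalize κ p x = c; generalize t x = d
    revert c d; decide
  obtain ⟨u, hu⟩ := hp
  let t' : I → ZMod 3 := fun x => if hx : x ≠ p then t ⟨x, hx⟩ else u
  have h0 : t' p = u := by simp [t']
  have h1 : ∀ x : {x // x ≠ p}, t' x = t x := fun x => by simp [t', x.2]
  obtain ⟨z, hz, hz'⟩ := hE (insert p (F.map (Function.Embedding.subtype _))) t' (by
    intro x hx y hy
    rw [Finset.mem_insert, Finset.mem_map] at hx hy
    rcases hx with rfl | ⟨x, hx, rfl⟩ <;> rcases hy with rfl | ⟨y, hy, rfl⟩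
    · rw [h.self, h0]
      exact (by decide : ∀ u : ZMod 3, ValidType 0 u u) u
    · simpa [h0, h1] using (hu y hy).1
    · have := (hu x hx).2
      rw [← h.swap] at this
      simpa [h0, h1] using this
    · simpa [h1] using ht x hx y hy)
  have hzp : z ≠ p := by
    rintro rfl
    exact hz (Finset.mem_insert_self _ _)
  exact ⟨⟨z, hzp⟩, fun hzF => hz (Finset.mem_insert_of_mem (Finset.mem_map.2 ⟨_, hzF, rfl⟩)),
    fun x hx => (hz' x (Finset.mem_insert_of_mem (Finset.mem_map.2 ⟨_, hx, rfl⟩))).trans (h1 x)⟩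

theorem HasExt.rotCode_subtype {I : Type} {κ : I → I → ZMod 3} (hE : HasExt κ) (h : IsPosCode κ)
    (p : I) : HasExt fun x y : {x // x ≠ p} => rotCode κ p x y := by
  classical
  intro F t ht
  let t' : I → ZMod 3 := fun x => if hx : x ≠ p then t ⟨x, hx⟩ else 0
  have h0 : t' p = 0 := by simp [t']
  have h1 : ∀ x : {x // x ≠ p}, t' x = t x := fun x => by simp [t', x.2]
  have hr : ∀ x, rotCode κ p p x = 0 := fun x => by simp [rotCode, h.self]
  have hr' : ∀ x, rotCode κ p x p = 0 := fun x => by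
    rw [(h.rotCode p).swap p x, hr, neg_zero]
  obtain ⟨u, hu⟩ := exists_shift_validType h p (insert p (F.map (Function.Embedding.subtype _))) t'
    (by
      intro x hx y hy
      rw [Finset.mem_insert, Finset.mem_map] at hx hy
      rcases hx with rfl | ⟨x, hx, rfl⟩ <;> rcases hy with rfl | ⟨y, hy, rfl⟩
      · rw [hr, h0]; decide
      · rw [hr, h0]; generalize t' _ = s; revert s; decide
      · rw [hr', h0]; generalize t' _ = s; revert s; decide
      · simpa [h1] using ht x hx y hy)
  obtain ⟨z, hz, hz'⟩ := hE _ _ hu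
  have hzp : z ≠ p := by
    rintro rfl
    exact hz (Finset.mem_insert_self _ _)
  refine ⟨⟨z, hzp⟩, fun hzF => hz (Finset.mem_insert_of_mem (Finset.mem_map.2 ⟨_, hzF, rfl⟩)),
    fun x hx => ?_⟩
  have e1 := hz' p (Finset.mem_insert_self _ _)
  have e2 := hz' x (Finset.mem_insert_of_mem (Finset.mem_map.2 ⟨_, hx, rfl⟩))
  rw [h0, h.self, sub_zero, zero_add] at e1
  rw [h1] at e2
  simp only [rotCode, e1, e2]
  ring

theorem behavesLikeId_of_ordCode {f : Equiv.Perm P} {X : Set P}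
    (h : ∀ x ∈ X, ∀ y ∈ X, ordCode (f x) (f y) = ordCode x y) : BehavesLikeId f X := by
  intro x hx y hy
  have h' := h x hx y hy
  refine ⟨fun hxy => ?_, fun hxy => ?_⟩
  · rwa [← ordCode_eq_one, h', ordCode_eq_one]
  · have hne : x ≠ y := by
      rintro rfl
      exact hxy.1 le_rfl
    rw [← ordCode_eq_zero hne, ← h'] at hxy
    exact (ordCode_eq_zero (f.injective.ne hne)).1 hxy

theorem isRotation_of_ordCode {f : Equiv.Perm P} {φ : P → ZMod 3}
    (h : ∀ x y, ordCode (f x) (f y) = ordCode x y + φ x - φ y)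
    (hX : ∀ x y, y < x → φ x = -1 → φ y = -1) (hZ : ∀ x y, x < y → φ x = 1 → φ y = 1)
    (hXZ : ∀ x z, φ x = -1 → φ z = 1 → x < z) : IsRotation f := by
  have hid : ∀ c, BehavesLikeId f {x | φ x = c} := fun c =>
    behavesLikeId_of_ordCode fun x hx y hy => by
      rw [h, show φ x = c from hx, show φ y = c from hy, add_sub_cancel_right]
  have hdis : ∀ c d, c ≠ d → Disjoint {x | φ x = c} {x | φ x = d} := fun c d hcd =>
    Set.disjoint_left.2 fun x hx hx' => hcd (hx.symm.trans hx')
  have hne : ∀ x y, φ x ≠ φ y → x ≠ y := fun x y hxy h => hxy (h ▸ rfl)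
  have hne' : ∀ x y, φ x ≠ φ y → f x ≠ f y := fun x y hxy h => hne x y hxy (f.injective h)
  have key : ∀ x y, φ y = φ x + 1 → (f y < f x ↔ Perp x y) ∧ (Perp (f x) (f y) ↔ x < y) := by
    intro x y hxy
    have hn : φ x ≠ φ y := by rw [hxy]; generalize φ x = c; revert c; decide
    rw [← ordCode_eq_neg_one, ← ordCode_eq_zero (hne _ _ hn), ← ordCode_eq_zero (hne' _ _ hn),
      ← ordCode_eq_one, h, hxy]
    generalize ordCode x y = c; generalize φ x = d
    revert c d; decide
  refine ⟨{x | φ x = -1}, {x | φ x = 0}, {x | φ x = 1}, fun p => ?_, hdis _ _ (by decide),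
    hdis _ _ (by decide), hdis _ _ (by decide), fun x y hyx hx => ?_, fun x y hyx hx => ?_,
    fun x hx z hz => hXZ x z hx hz, hid _, hid _, hid _, fun x hx z hz => ?_, fun x hx y hy => ?_,
    fun y hy z hz => ?_⟩
  · rcases ZMod3_cases (φ p) with h | h | h
    · exact Or.inr (Or.inl h)
    · exact Or.inr (Or.inr h)
    · exact Or.inl h
  · rcases hyx.lt_or_eq with h | rfl
    · exact hX _ _ h hx
    · exact hx
  · rcases hyx.lt_or_eq with h | rfl
    · exact hZ _ _ h hx
    · exact hx
  · rw [← ordCode_eq_neg_one, h, ordCode_eq_one.2 (hXZ _ _ hx hz), show φ x = -1 from hx,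
      show φ z = 1 from hz]
    decide
  · exact key x y (by rw [show φ x = -1 from hx, show φ y = 0 from hy]; decide)
  · exact key y z (by rw [show φ z = 1 from hz, show φ y = 0 from hy]; decide)

/-- The rotation at a point: after removing `p`, which does not change the order up to
isomorphism, the order is rotated at `p`. -/
theorem exists_rotation [Countable P] (hU : IsUniversal P) (hH : IsHomogeneous P) (p : P) :
    ∃ (f : Equiv.Perm P) (h : P ≃ {x // x ≠ p}), IsRotation f ∧
      (∀ x y, ordCode (h x : P) (h y) = ordCode x y) ∧
      ∀ x y, ordCode (f x) (f y) = rotCode ordCode p (h x : P) (h y) := by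
  have hp := isPosCode_ordCode (P := P)
  have hE := hasExt_ordCode hU hH
  obtain ⟨h, hh⟩ := exists_equiv_of_hasExt hp (hp.comap _) hE (hE.subtype_ne hp p)
  obtain ⟨f, hf⟩ := exists_equiv_of_hasExt ((hp.rotCode p).comap _) hp
    (hE.rotCode_subtype hp p) hE
  refine ⟨h.trans f, h, ?_, hh, fun x y => hf _ _⟩
  have hlt : ∀ x y, (h x : P) < h y ↔ x < y := fun x y => by
    rw [← ordCode_eq_one, hh, ordCode_eq_one]
  refine isRotation_of_ordCode (φ := fun x => ordCode p (h x)) (fun x y => ?_) ?_ ?_ ?_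
  · rw [Equiv.trans_apply, Equiv.trans_apply, hf, rotCode, hh]
    ring
  · intro x y hyx hx
    rw [ordCode_eq_neg_one] at hx ⊢
    exact ((hlt _ _).2 hyx).trans hx
  · intro x y hxy hx
    rw [ordCode_eq_one] at hx ⊢
    exact hx.trans ((hlt _ _).2 hxy)
  · intro x z hx hz
    rw [ordCode_eq_neg_one] at hx
    rw [ordCode_eq_one] at hz
    exact (hlt _ _).1 (hx.trans hz)

/-- A closed group of permutations of the random partial order that contains all rotations. -/
structure IsTurnGroup (G : Subgroup (Equiv.Perm P)) : Prop where
  countable : Countable P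
  universal : IsUniversal P
  homogeneous : IsHomogeneous P
  closed : IsClosedSubgroup G
  rotation_mem : ∀ f : Equiv.Perm P, IsRotation f → f ∈ G

/-- Some tuple with code `κ` is sent by the group to a tuple with code `κ'`. -/
def CodeEquiv (G : Subgroup (Equiv.Perm P)) {I : Type} (κ κ' : I → I → ZMod 3) : Prop :=
  ∃ a : I → P, Function.Injective a ∧ (∀ i j, ordCode (a i) (a j) = κ i j) ∧
    ∃ g ∈ G, ∀ i j, ordCode (g (a i)) (g (a j)) = κ' i j

theorem codeEquiv_of_mem {G : Subgroup (Equiv.Perm P)} {I : Type} {a : I → P}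
    (ha : Function.Injective a) {g : Equiv.Perm P} (hg : g ∈ G) :
    CodeEquiv G (fun i j => ordCode (a i) (a j)) fun i j => ordCode (g (a i)) (g (a j)) :=
  ⟨a, ha, fun _ _ => rfl, g, hg, fun _ _ => rfl⟩

namespace CodeEquiv

variable {G : Subgroup (Equiv.Perm P)} {I J : Type} {κ κ' κ'' : I → I → ZMod 3}

theorem isPosCode_left (h : CodeEquiv G κ κ') : IsPosCode κ := by
  obtain ⟨a, -, h, -⟩ := h
  have := isPosCode_ordCode.comap a
  rwa [show (fun i j => ordCode (a i) (a j)) = κ from funext₂ h] at this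

theorem isPosCode_right (h : CodeEquiv G κ κ') : IsPosCode κ' := by
  obtain ⟨a, -, -, g, -, h⟩ := h
  have := isPosCode_ordCode.comap (g ∘ a)
  rwa [show (fun i j => ordCode ((g ∘ a) i) ((g ∘ a) j)) = κ' from funext₂ h] at this

theorem symm (h : CodeEquiv G κ κ') : CodeEquiv G κ' κ := by
  obtain ⟨a, ha, h, g, hg, h'⟩ := h
  exact ⟨g ∘ a, g.injective.comp ha, h', g⁻¹, G.inv_mem hg, by simpa using h⟩

theorem comap (h : CodeEquiv G κ κ') {f : J → I} (hf : Function.Injective f) :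
    CodeEquiv G (fun i j => κ (f i) (f j)) fun i j => κ' (f i) (f j) := by
  obtain ⟨a, ha, h, g, hg, h'⟩ := h
  exact ⟨a ∘ f, ha.comp hf, fun _ _ => h _ _, g, hg, fun _ _ => h' _ _⟩

end CodeEquiv

namespace IsTurnGroup

variable {G : Subgroup (Equiv.Perm P)} {I J : Type} {κ κ' κ'' : I → I → ZMod 3}

theorem orderIso_mem (hG : IsTurnGroup G) (g : P ≃o P) : g.toEquiv ∈ G := by
  refine hG.rotation_mem _ (isRotation_of_ordCode (φ := fun _ => 0) (fun x y => ?_)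
    (fun _ _ _ h => h) (fun _ _ _ h => h) fun _ _ h => ?_)
  · rw [add_zero, sub_zero]
    exact ordCode_eq_iff.2 ⟨g.lt_iff_lt, g.lt_iff_lt⟩
  · exact absurd h (by decide)

theorem exists_mem_of_ordCode_eq [Finite I] (hG : IsTurnGroup G) {a b : I → P}
    (ha : Function.Injective a) (hb : Function.Injective b)
    (h : ∀ i j, ordCode (a i) (a j) = ordCode (b i) (b j)) : ∃ g ∈ G, ∀ i, g (a i) = b i := by
  obtain ⟨g, hg⟩ := exists_orderIso_of_ordCode_eq hG.homogeneous ha hb h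
  exact ⟨g.toEquiv, hG.orderIso_mem g, hg⟩

theorem exists_mem_of_codeEquiv [Finite I] (hG : IsTurnGroup G) (h : CodeEquiv G κ κ') {a : I → P}
    (ha : Function.Injective a) (ha' : ∀ i j, ordCode (a i) (a j) = κ i j) :
    ∃ g ∈ G, ∀ i j, ordCode (g (a i)) (g (a j)) = κ' i j := by
  obtain ⟨b, hb, hb', g, hg, h⟩ := h
  obtain ⟨k, hk, hkb⟩ := hG.exists_mem_of_ordCode_eq ha hb fun i j => by rw [ha', hb']
  exact ⟨g * k, G.mul_mem hg hk, fun i j => by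
    rw [Equiv.Perm.mul_apply, Equiv.Perm.mul_apply, hkb, hkb, h]⟩

theorem codeEquiv_refl [Finite I] (hG : IsTurnGroup G) (h : IsPosCode κ) : CodeEquiv G κ κ := by
  obtain ⟨a, ha, ha'⟩ := exists_ordCode_eq hG.universal h
  exact ⟨a, ha, ha', 1, G.one_mem, ha'⟩

theorem codeEquiv_trans [Finite I] (hG : IsTurnGroup G) (h : CodeEquiv G κ κ')
    (h' : CodeEquiv G κ' κ'') : CodeEquiv G κ κ'' := by
  obtain ⟨a, ha, h, g, hg, hga⟩ := h
  obtain ⟨k, hk, hka⟩ := hG.exists_mem_of_codeEquiv h' (g.injective.comp ha) hga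
  exact ⟨a, ha, h, k * g, G.mul_mem hk hg, hka⟩

/-- An equivalence of codes can be extended to larger codes. -/
theorem exists_codeEquiv_extend [Finite I] [Finite J] (hG : IsTurnGroup G) (h : CodeEquiv G κ κ')
    {f : I → J} (hf : Function.Injective f) {μ : J → J → ZMod 3} (hμ : IsPosCode μ)
    (hμκ : ∀ i j, μ (f i) (f j) = κ i j) :
    ∃ μ', CodeEquiv G μ μ' ∧ ∀ i j, μ' (f i) (f j) = κ' i j := by
  obtain ⟨a, ha, ha'⟩ := exists_ordCode_eq hG.universal hμ
  obtain ⟨g, hg, hga⟩ := hG.exists_mem_of_codeEquiv h (ha.comp hf) fun i j =>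
    (ha' _ _).trans (hμκ i j)
  exact ⟨_, ⟨a, ha, ha', g, hg, fun _ _ => rfl⟩, hga⟩

theorem codeEquiv_rotCode [Finite I] (hG : IsTurnGroup G) (h : IsPosCode κ) (i₀ : I) :
    CodeEquiv G κ (rotCode κ i₀) := by
  obtain ⟨c, hc, hc'⟩ := exists_ordCode_eq hG.universal (h.comap fun o : Option I => o.getD i₀)
  have := hG.countable
  obtain ⟨f, e, hf, he, hfe⟩ := exists_rotation hG.universal hG.homogeneous (c none)
  have hne : ∀ i, c (some i) ≠ c none := fun i => hc.ne (by simp)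
  refine ⟨fun i => e.symm ⟨c (some i), hne i⟩, fun i j hij => ?_, fun i j => ?_, f,
    hG.rotation_mem f hf, fun i j => ?_⟩
  · have := congrArg Subtype.val (e.symm.injective hij)
    simpa using hc this
  · rw [← he, e.apply_symm_apply, e.apply_symm_apply, hc']
    rfl
  · rw [hfe, e.apply_symm_apply, e.apply_symm_apply]
    simp only [rotCode, hc']
    rfl

theorem codeEquiv_of_eq_add_sub [Finite I] (hG : IsTurnGroup G) (h : IsPosCode κ)
    (h' : IsPosCode κ') (φ : I → ZMod 3) (hφ : ∀ i j, κ' i j = κ i j + φ i - φ j) :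
    CodeEquiv G κ κ' := by
  rcases isEmpty_or_nonempty I with hI | ⟨⟨i₀⟩⟩
  · rw [show κ' = κ from funext fun i => hI.elim i]
    exact hG.codeEquiv_refl h
  · refine hG.codeEquiv_trans (hG.codeEquiv_rotCode h i₀) ?_
    have : rotCode κ i₀ = rotCode κ' i₀ := by
      funext i j
      simp only [rotCode, hφ]
      ring
    rw [this]
    exact (hG.codeEquiv_rotCode h' i₀).symm

theorem mem_of_forall_codeEquiv (hG : IsTurnGroup G) {f : Equiv.Perm P}
    (h : ∀ (I : Type) [Finite I] (a : I → P), Function.Injective a →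
      CodeEquiv G (fun i j => ordCode (a i) (a j)) fun i j => ordCode (f (a i)) (f (a j))) :
    f ∈ G := by
  refine hG.closed f fun S => ?_
  obtain ⟨g, hg, hga⟩ := hG.exists_mem_of_codeEquiv (h S (fun x => x.1) Subtype.val_injective)
    Subtype.val_injective fun _ _ => rfl
  obtain ⟨k, hk, hkf⟩ := hG.exists_mem_of_ordCode_eq (a := fun x : S => g x.1)
    (b := fun x : S => f x.1) (g.injective.comp Subtype.val_injective)
    (f.injective.comp Subtype.val_injective) hga
  exact ⟨k * g, G.mul_mem hk hg, fun x hx => hkf ⟨x, hx⟩⟩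

end IsTurnGroup

/-- The code of a disjoint union of incomparable parts. -/
def sumCode {I J : Type} (κ : I → I → ZMod 3) (ρ : J → J → ZMod 3) : I ⊕ J → I ⊕ J → ZMod 3
  | .inl i, .inl j => κ i j
  | .inl _, .inr _ => 0
  | .inr _, .inl _ => 0
  | .inr i, .inr j => ρ i j

theorem IsPosCode.sumCode {I J : Type} {κ : I → I → ZMod 3} {ρ : J → J → ZMod 3}
    (h : IsPosCode κ) (h' : IsPosCode ρ) : IsPosCode (sumCode κ ρ) where
  self i := by rcases i with i | i <;> simp [_root_.sumCode, h.self, h'.self]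
  swap i j := by
    rcases i with i | i <;> rcases j with j | j <;>
      simp [_root_.sumCode, ← h.swap, ← h'.swap]
  trans i j k := by
    rcases i with i | i <;> rcases j with j | j <;> rcases k with k | k <;>
      simp only [_root_.sumCode] <;> intro h1 h2
    any_goals exact absurd h1 zero_ne_one
    any_goals exact absurd h2 zero_ne_one
    · exact h.trans _ _ _ h1 h2
    · exact h'.trans _ _ _ h1 h2

/-- The codes stay equivalent after adding any code incomparable to both. -/
def StrongEquiv (G : Subgroup (Equiv.Perm P)) {I : Type} (κ κ' : I → I → ZMod 3) : Prop :=
  ∀ (J : Type) [Finite J] (ρ : J → J → ZMod 3), IsPosCode ρ →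
    CodeEquiv G (sumCode κ ρ) (sumCode κ' ρ)

namespace StrongEquiv

variable {G : Subgroup (Equiv.Perm P)} {I J : Type} {κ κ' κ'' : I → I → ZMod 3}

theorem symm (h : StrongEquiv G κ κ') : StrongEquiv G κ' κ := fun J _ ρ hρ => (h J ρ hρ).symm

theorem trans [Finite I] (hG : IsTurnGroup G) (h : StrongEquiv G κ κ')
    (h' : StrongEquiv G κ' κ'') : StrongEquiv G κ κ'' :=
  fun J _ ρ hρ => hG.codeEquiv_trans (h J ρ hρ) (h' J ρ hρ)

theorem refl [Finite I] (hG : IsTurnGroup G) (h : IsPosCode κ) : StrongEquiv G κ κ :=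
  fun _ _ _ hρ => hG.codeEquiv_refl (h.sumCode hρ)

theorem codeEquiv (h : StrongEquiv G κ κ') : CodeEquiv G κ κ' :=
  (h Empty (fun _ _ => 0) ⟨fun _ => rfl, fun _ _ => by simp, fun i => i.elim⟩).comap
    (f := Sum.inl) Sum.inl_injective

theorem comap (h : StrongEquiv G κ κ') {f : J → I} (hf : Function.Injective f) :
    StrongEquiv G (fun i j => κ (f i) (f j)) fun i j => κ' (f i) (f j) := by
  intro K _ ρ hρ
  have := (h K ρ hρ).comap (f := Sum.map f id) (hf.sumMap Function.injective_id)
  convert this using 3 with x y x y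
  all_goals
    rcases x with x | x <;> rcases y with y | y <;> rfl

end StrongEquiv

/-- The sum of a code around a triangle. -/
def cycSum {I : Type} (κ : I → I → ZMod 3) (a b c : I) : ZMod 3 := κ a b + κ b c + κ c a

theorem Pari.ne {a b c : P} (h : Pari a b c) : a ≠ b ∧ b ≠ c ∧ a ≠ c := by
  have hp : ∀ x y : P, Perp x y → x ≠ y := fun x y h e => h.1 e.le
  rcases h with ⟨h1, h2, h3⟩ | ⟨h1, h2, h3⟩ | ⟨h1, h2, h3⟩ | ⟨h1, h2, h3⟩ | ⟨h1, h2, h3⟩ |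
    ⟨h1, h2, h3⟩ | ⟨h1, h2, h3⟩
  · exact ⟨hp _ _ h1, hp _ _ h2, hp _ _ h3⟩
  · exact ⟨h1.ne, hp _ _ h3, h2.ne⟩
  · exact ⟨h1.ne', h2.ne, hp _ _ h3⟩
  · exact ⟨hp _ _ h3, h2.ne', h1.ne'⟩
  · exact ⟨h1.ne', hp _ _ h3, h2.ne'⟩
  · exact ⟨h1.ne, h2.ne', hp _ _ h3⟩
  · exact ⟨hp _ _ h3, h2.ne, h1.ne⟩

set_option synthInstance.maxSize 4000 in
set_option synthInstance.maxHeartbeats 200000 in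
theorem pari_iff {a b c : P} (hab : a ≠ b) (hbc : b ≠ c) (hac : a ≠ c) :
    Pari a b c ↔ cycSum ordCode a b c = 0 := by
  have hv := (isPosCode_ordCode (P := P)).validTriple a b c
  have hlt : ∀ x y : P, y < x ↔ ordCode x y = -1 := fun x y => ordCode_eq_neg_one.symm
  unfold Pari cycSum
  rw [← ordCode_eq_zero hab, ← ordCode_eq_zero hbc, ← ordCode_eq_zero hac]
  simp only [← ordCode_eq_one]
  rw [ordCode_swap a b, ordCode_swap a c, ordCode_swap b c]
  revert hv
  generalize ordCode a b = x; generalize ordCode b c = y; generalize ordCode a c = z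
  revert x y z
  decide

section Rotation

variable {f : Equiv.Perm P} {φ : P → ZMod 3}

theorem below_of_below_aux : ∀ xy xz yz : ZMod 3, ValidTriple xy xz yz →
    ValidTriple (xy - 1) (xz - 1) yz → xy = -1 → xz = -1 := by
  decide

theorem below_of_below_aux' : ∀ xy xz yz : ZMod 3, ValidTriple xy xz yz →
    ValidTriple (xy + 1) (xz + 1) yz → xy = 1 → xz = 1 := by
  decide

theorem below_of_below (h : ∀ x y, ordCode (f x) (f y) = ordCode x y + φ x - φ y) {x x' y y' : P}
    (hy : φ y = φ x + 1) (hy' : φ y' = φ x + 1) (hx' : φ x' = φ x) (hyx : y < x) : y' < x' := by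
  have hc := isPosCode_ordCode (P := P)
  have h1 : y' < x := by
    rw [← ordCode_eq_neg_one] at hyx ⊢
    have h1 := hc.validTriple x y y'
    have h2 := hc.validTriple (f x) (f y) (f y')
    simp only [h, hy, hy'] at h2
    refine below_of_below_aux _ _ _ h1 ?_ hyx
    convert h2 using 1 <;> ring
  rw [← ordCode_eq_one] at h1 ⊢
  have h2 := hc.validTriple y' x x'
  have h3 := hc.validTriple (f y') (f x) (f x')
  simp only [h, hx', hy'] at h3
  refine below_of_below_aux' _ _ _ h2 ?_ h1
  convert h3 using 1 <;> ring

theorem isRotation_of_add_sub (h : ∀ x y, ordCode (f x) (f y) = ordCode x y + φ x - φ y) :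
    IsRotation f := by
  have hc := isPosCode_ordCode (P := P)
  have e0 : ∀ i : ZMod 3, i + 1 + 1 + 1 = i := by decide
  have e1 : ∀ a i : ZMod 3, a - i + 1 = -1 → a = i + 1 := by decide
  have e2 : ∀ a i : ZMod 3, a - i + 1 = 1 → a = i := by decide
  have e3 : ∀ a i : ZMod 3, a ≠ i → a ≠ i + 1 + 1 → a = i + 1 := by decide
  let Q : ZMod 3 → Prop := fun i => ∃ x y, φ x = i ∧ φ y = i + 1 ∧ y < x
  have hQ : ∀ i, Q i → ∀ x y, φ x = i → φ y = i + 1 → y < x := by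
    rintro i ⟨x, y, rfl, hy, hyx⟩ x' y' hx' hy'
    exact below_of_below h hy hy' hx' hyx
  have hQ1 : ∀ i, Q i → ¬ Q (i + 1) := by
    rintro i ⟨x, y, rfl, hy, hyx⟩ ⟨y', z, hy', hz, hzy⟩
    have hzy' : z < y := hQ _ ⟨y', z, hy', hz, hzy⟩ y z hy hz
    have h1 := (hzy'.trans hyx)
    have h2 := hc.validTriple (f x) (f y) (f z)
    rw [← ordCode_eq_neg_one] at hyx h1 hzy'
    simp only [h, hz, hy, hyx, h1, hzy'] at h2
    revert h2
    generalize φ x = d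
    revert d; decide
  obtain ⟨i, hi1, hi2, hi⟩ : ∃ i, ¬ Q (i + 1) ∧ ¬ Q (i + 1 + 1) ∧ (Q i ∨ ∀ x, φ x ≠ i) := by
    by_cases hQe : ∃ i, Q i
    · obtain ⟨i, hi⟩ := hQe
      refine ⟨i, hQ1 i hi, fun h' => hQ1 _ h' ?_, Or.inl hi⟩
      rwa [e0]
    · push Not at hQe
      by_contra! hcon
      obtain ⟨x, hx⟩ := (hcon 0 (hQe _) (hQe _)).2
      obtain ⟨y, hy⟩ := (hcon 1 (hQe _) (hQe _)).2
      obtain ⟨z, hz⟩ := (hcon (-1) (hQe _) (hQe _)).2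
      have h1 : ordCode x y ≠ -1 := fun h => hQe 0 ⟨x, y, hx, hy, ordCode_eq_neg_one.1 h⟩
      have h2 : ordCode y z ≠ -1 := fun h => hQe 1 ⟨y, z, hy, hz, ordCode_eq_neg_one.1 h⟩
      have h3 : ordCode x z ≠ 1 := fun h => hQe (-1) ⟨z, x, hz, hx, ordCode_eq_one.1 h⟩
      have h4 := hc.validTriple (f x) (f y) (f z)
      have h5 := hc.validTriple x y z
      simp only [h, hx, hy, hz] at h4
      revert h1 h2 h3 h4 h5
      generalize ordCode x y = a; generalize ordCode y z = b; generalize ordCode x z = c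
      revert a b c
      decide
  refine isRotation_of_ordCode (φ := fun x => φ x - i + 1) (fun x y => by rw [h]; ring) ?_ ?_ ?_
  · intro x y hyx hx
    have hx' := e1 _ _ hx
    suffices φ y = φ x by rwa [this]
    rw [hx']
    refine e3 _ _ (fun hy => ?_) (fun hy => ?_)
    · exact (hQ i (hi.resolve_right fun h => h _ hy) _ _ hy hx').asymm hyx
    · exact hi1 ⟨x, y, hx', hy, hyx⟩
  · intro x y hxy hx
    have hx' := e2 _ _ hx
    suffices φ y = φ x by rwa [this]
    rw [hx']
    by_contra hy
    by_cases hy2 : φ y = i + 1 + 1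
    · refine hi2 ⟨y, x, hy2, ?_, hxy⟩
      rw [hx', e0]
    · exact (hQ i (hi.resolve_right fun h => h _ hx') _ _ hx' (e3 _ _ hy hy2)).asymm hxy
  · intro x z hx hz
    exact hQ i (hi.resolve_right fun h => h _ (e2 _ _ hz)) _ _ (e2 _ _ hz) (e1 _ _ hx)

theorem isRotation_of_cycSum
    (h : ∀ x y z, cycSum ordCode (f x) (f y) (f z) = cycSum ordCode x y z) : IsRotation f := by
  rcases isEmpty_or_nonempty P with hP | ⟨⟨p⟩⟩
  · exact isRotation_of_add_sub (φ := fun _ => 0) fun x => hP.elim x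
  · refine isRotation_of_add_sub (φ := fun x => ordCode (f x) (f p) - ordCode x p) fun x y => ?_
    have := h x y p
    unfold cycSum at this
    rw [ordCode_swap (f x) (f p), ordCode_swap x p] at this
    linear_combination this

end Rotation

section Edges

variable {A : Type} {κ : A → A → ZMod 3}

/-- A point above a given down-closed part of a finite set and incomparable to the rest. -/
theorem HasExt.exists_above (hE : HasExt κ) (F : Finset A) (U : Set A)
    (hU : ∀ x ∈ F, ∀ y ∈ U, κ x y = 1 → x ∈ U) :
    ∃ z ∉ F, (∀ x ∈ F, x ∈ U → κ x z = 1) ∧ ∀ x ∈ F, x ∉ U → κ x z = 0 := by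
  classical
  obtain ⟨z, hz, h⟩ := hE F (fun x => if x ∈ U then 1 else 0) (by
    intro x hx y hy
    refine ⟨fun hxy h => ?_, fun _ h => ?_, fun _ h => ?_⟩
    · have hyU : y ∈ U := by
        by_contra h'
        rw [if_neg h'] at h
        exact absurd h (by decide)
      exact if_pos (hU x hx y hyU hxy)
    all_goals
      split_ifs at h <;> exact absurd h (by decide))
  refine ⟨z, hz, fun x hx hxU => ?_, fun x hx hxU => ?_⟩
  · rw [h x hx, if_pos hxU]
  · rw [h x hx, if_neg hxU]

/-- A point below a given up-closed part of a finite set and incomparable to the rest. -/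
theorem HasExt.exists_below (hE : HasExt κ) (F : Finset A) (U : Set A)
    (hU : ∀ x ∈ F, ∀ y ∈ U, κ y x = 1 → x ∈ U) (h : IsPosCode κ) :
    ∃ z ∉ F, (∀ x ∈ F, x ∈ U → κ z x = 1) ∧ ∀ x ∈ F, x ∉ U → κ z x = 0 := by
  classical
  obtain ⟨z, hz, ht⟩ := hE F (fun x => if x ∈ U then -1 else 0) (by
    intro x hx y hy
    refine ⟨fun _ h => ?_, fun hxy h => ?_, fun h _ => ?_⟩
    · split_ifs at h <;> exact absurd h (by decide)
    · have hxU : x ∈ U := by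
        by_contra h'
        rw [if_neg h'] at h
        exact absurd h (by decide)
      exact if_pos (hU y hy x hxU hxy)
    · split_ifs at h <;> exact absurd h (by decide))
  refine ⟨z, hz, fun x hx hxU => ?_, fun x hx hxU => ?_⟩
  · rw [h.swap x z, ht x hx, if_pos hxU, neg_neg]
  · rw [h.swap x z, ht x hx, if_neg hxU, neg_zero]

variable {X : Type} {e : A → A → X}

theorem exists_isolated_edge (hE : HasExt κ) (h : IsPosCode κ)
    (h1 : ∀ x y w, κ x y = 1 → κ x w = 1 → κ y w = 0 → e x y = e x w)
    (h2 : ∀ x v y, κ x y = 1 → κ v y = 1 → κ x v = 0 → e x y = e v y)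
    {x y : A} (hxy : κ x y = 1) (F : Finset A) :
    ∃ v w, κ v w = 1 ∧ (∀ p ∈ F, κ p v = 0) ∧ e x y = e v w := by
  classical
  obtain ⟨w, hw, hw1, hw2⟩ := hE.exists_above (insert x (insert y F)) {p | p = x ∨ κ p x = 1} (by
    rintro p - q (rfl | hq) hpq
    · exact Or.inr hpq
    · exact Or.inr (h.trans _ _ _ hpq hq))
  obtain ⟨v, -, hv1, hv2⟩ := hE.exists_below (insert w (insert x (insert y F))) {w} (by
    rintro p hp q rfl hpq
    rcases Finset.mem_insert.1 hp with rfl | hp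
    · rfl
    rw [h.swap p q, neg_eq_iff_eq_neg] at hpq
    by_cases hpU : p ∈ {p | p = x ∨ κ p x = 1}
    · rw [hw1 p hp hpU] at hpq; exact absurd hpq (by decide)
    · rw [hw2 p hp hpU] at hpq; exact absurd hpq (by decide)) h
  have hxw : κ x w = 1 := hw1 x (by simp) (Or.inl rfl)
  have hyw : κ y w = 0 := hw2 y (by simp) (by
    rintro (rfl | hyx)
    · rw [h.self] at hxy; exact absurd hxy (by decide)
    · rw [h.swap, hxy] at hyx; exact absurd hyx (by decide))
  have hvp : ∀ p ∈ insert x (insert y F), κ p v = 0 := fun p hp => by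
    rw [h.swap, hv2 p (Finset.mem_insert_of_mem hp) (fun hpw => hw (hpw ▸ hp)), neg_zero]
  have hvw := hv1 w (by simp) rfl
  refine ⟨v, w, hvw, fun p hp => hvp p (by simp [hp]), ?_⟩
  rw [h1 x y w hxy hxw hyw, h2 x v w hxw hvw (hvp x (by simp))]

/-- A quantity on comparable pairs that is locally constant is constant. -/
theorem eq_of_edges (hE : HasExt κ) (h : IsPosCode κ)
    (h1 : ∀ x y w, κ x y = 1 → κ x w = 1 → κ y w = 0 → e x y = e x w)
    (h2 : ∀ x v y, κ x y = 1 → κ v y = 1 → κ x v = 0 → e x y = e v y)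
    {x y x' y' : A} (hxy : κ x y = 1) (hxy' : κ x' y' = 1) : e x y = e x' y' := by
  classical
  obtain ⟨v, w, hvw, -, hv⟩ := exists_isolated_edge hE h h1 h2 hxy ∅
  obtain ⟨v', w', hvw', hF, hv'⟩ := exists_isolated_edge hE h h1 h2 hxy' {v, w}
  have hvv : κ v v' = 0 := hF v (by simp)
  have hwv : κ w v' = 0 := hF w (by simp)
  have n1 : κ w v ≠ 1 := by rw [h.swap, hvw]; decide
  have n2 : κ w' v' ≠ 1 := by rw [h.swap, hvw']; decide
  have n3 : κ w' v ≠ 1 := fun h3 => by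
    have := h.trans _ _ _ hvw' h3
    rw [h.swap, hvv] at this
    exact absurd this (by decide)
  have e1 : ∀ p q, κ p q = 1 → p ≠ q := by
    rintro p q hpq rfl
    rw [h.self] at hpq
    exact absurd hpq (by decide)
  have e2 : w ≠ v' := fun h' => by
    rw [← h'] at hvv
    rw [hvv] at hvw
    exact absurd hvw (by decide)
  have e3 : w' ≠ v := fun h' => by
    rw [h', h.swap, hvv] at hvw'
    exact absurd hvw' (by decide)
  obtain ⟨z, -, hz1, hz2⟩ := hE.exists_above {v, w, v', w'} {v, v'} (by
    intro p hp q hq hpq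
    simp only [Finset.mem_insert, Finset.mem_singleton] at hp
    rcases hp with rfl | rfl | rfl | rfl
    · simp
    · rcases hq with rfl | rfl
      · exact absurd hpq n1
      · rw [hwv] at hpq; exact absurd hpq (by decide)
    · simp
    · rcases hq with rfl | rfl
      · exact absurd hpq n3
      · exact absurd hpq n2)
  have hvz := hz1 v (by simp) (by simp)
  have hvz' := hz1 v' (by simp) (by simp)
  have hwz := hz2 w (by simp) (by simp [(e1 _ _ hvw).symm, e2])
  have hwz' := hz2 w' (by simp) (by simp [(e1 _ _ hvw').symm, e3])
  rw [hv, hv', h1 v w z hvw hvz hwz, h2 v v' z hvz hvz' hvv, ← h1 v' w' z hvw' hvz' hwz']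

end Edges

theorem cycSum_rotate {I : Type} (κ : I → I → ZMod 3) (a b c : I) :
    cycSum κ b c a = cycSum κ a b c := by
  unfold cycSum; ring

theorem IsPosCode.cycSum_swap {I : Type} {κ : I → I → ZMod 3} (h : IsPosCode κ) (a b c : I) :
    cycSum κ a c b = -cycSum κ a b c := by
  unfold cycSum
  rw [h.swap b c, h.swap a b, h.swap c a]
  ring

theorem IsPosCode.cycSum_eq {I : Type} {κ : I → I → ZMod 3} (h : IsPosCode κ) (a b c : I) :
    cycSum κ a b c = κ a b + κ b c - κ a c := by
  unfold cycSum
  rw [h.swap a c]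
  ring

section Sign

variable {f : Equiv.Perm P}

/-- The sign by which `f` changes the sum around a triangle. -/
noncomputable def cycSign (f : Equiv.Perm P) (a b c : P) : ZMod 3 :=
  cycSum ordCode a b c * cycSum ordCode (f a) (f b) (f c)

theorem cycSign_rotate (a b c : P) : cycSign f b c a = cycSign f a b c := by
  unfold cycSign
  rw [cycSum_rotate ordCode a b c, cycSum_rotate ordCode (f a) (f b) (f c)]

theorem cycSign_swap (a b c : P) : cycSign f a c b = cycSign f a b c := by
  unfold cycSign
  rw [isPosCode_ordCode.cycSum_swap a b c, isPosCode_ordCode.cycSum_swap (f a) (f b) (f c),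
    neg_mul_neg]

theorem cycSign_eq_of_link
    (hf : ∀ a b c, cycSum ordCode (f a) (f b) (f c) = 0 ↔ cycSum ordCode a b c = 0) {x y z w : P}
    (h2 : cycSum ordCode x z w = 0)
    (h3 : cycSum ordCode y z w = 0) : cycSign f x y z = cycSign f x y w := by
  have key : ∀ x y z w : P, cycSum ordCode y z w - cycSum ordCode x z w + cycSum ordCode x y w
      - cycSum ordCode x y z = 0 := by
    intro x y z w
    simp only [isPosCode_ordCode.cycSum_eq]
    ring
  have k1 := key x y z w
  have k2 := key (f x) (f y) (f z) (f w)
  rw [h2, h3] at k1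
  rw [(hf _ _ _).2 h2, (hf _ _ _).2 h3] at k2
  unfold cycSign
  have e1 : cycSum ordCode x y w = cycSum ordCode x y z := by linear_combination k1
  have e2 : cycSum ordCode (f x) (f y) (f w) = cycSum ordCode (f x) (f y) (f z) := by
    linear_combination k2
  rw [e1, e2]

theorem cycSum_eq_rotCode (z x y : P) : cycSum ordCode z x y = rotCode ordCode z x y := by
  rw [isPosCode_ordCode.cycSum_eq, rotCode]

theorem cycSum_ne_zero_ne {a b c : P} (h : cycSum ordCode a b c ≠ 0) : a ≠ b ∧ b ≠ c ∧ a ≠ c := by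
  have hc := isPosCode_ordCode (P := P)
  rw [hc.cycSum_eq] at h
  refine ⟨?_, ?_, ?_⟩ <;> rintro rfl <;> apply h
  · rw [hc.self]; ring
  · rw [hc.self]; ring
  · rw [hc.self, hc.swap]; ring

theorem cycSign_eq_of_common (hE : HasExt (ordCode (P := P)))
    (hf : ∀ a b c, cycSum ordCode (f a) (f b) (f c) = 0 ↔ cycSum ordCode a b c = 0)
    {z x y x' y' : P} (h : cycSum ordCode z x y ≠ 0) (h' : cycSum ordCode z x' y' ≠ 0) :
    cycSign f z x y = cycSign f z x' y' := by
  have hc := isPosCode_ordCode (P := P)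
  have key : ∀ x y : P, cycSum ordCode z x y ≠ 0 → ∃ x' y' : {x // x ≠ z},
      rotCode ordCode z x' y' = 1 ∧ cycSign f z x y = cycSign f z x' y' := by
    intro x y hxy
    obtain ⟨h1, h2, h3⟩ := cycSum_ne_zero_ne hxy
    rcases ZMod3_cases (cycSum ordCode z x y) with h0 | h0 | h0
    · exact absurd h0 hxy
    · exact ⟨⟨x, h1.symm⟩, ⟨y, h3.symm⟩, by rwa [← cycSum_eq_rotCode], rfl⟩
    · refine ⟨⟨y, h3.symm⟩, ⟨x, h1.symm⟩, ?_, (cycSign_swap _ _ _).symm⟩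
      rw [← cycSum_eq_rotCode, hc.cycSum_swap, h0, neg_neg]
  obtain ⟨u, v, huv, he⟩ := key x y h
  obtain ⟨u', v', huv', he'⟩ := key x' y' h'
  rw [he, he']
  refine eq_of_edges (e := fun x y : {x // x ≠ z} => cycSign f z x y) (hE.rotCode_subtype hc z)
    ((hc.rotCode z).comap _) ?_ ?_ huv huv'
  · intro x y w hxy hxw hyw
    rw [← cycSum_eq_rotCode] at hxy hxw hyw
    refine cycSign_eq_of_link hf hyw ?_
    rw [hc.cycSum_eq] at *
    linear_combination hxy - hxw + hyw
  · intro x v y hxy hxw hyw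
    rw [← cycSum_eq_rotCode] at hxy hxw hyw
    rw [← cycSign_swap z x y, ← cycSign_swap z v y]
    refine cycSign_eq_of_link hf hyw ?_
    rw [hc.cycSum_eq] at *
    rw [hc.swap x y]
    linear_combination hxw - hxy + hyw - hc.swap v y

theorem exists_cycSum_ne_zero (hE : HasExt (ordCode (P := P))) (z w : P) :
    ∃ x, cycSum ordCode z w x ≠ 0 ∨ z = w := by
  classical
  have hc := isPosCode_ordCode (P := P)
  by_cases hzw : z = w
  · exact ⟨z, Or.inr hzw⟩
  rcases ZMod3_cases (ordCode z w) with h0 | h0 | h0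
  · obtain ⟨x, -, hx1, hx2⟩ := hE.exists_above {z, w} {z} (by
      rintro x hx y rfl hxy
      rcases Finset.mem_insert.1 hx with rfl | hx
      · rfl
      · rw [Finset.mem_singleton.1 hx, hc.swap, h0] at hxy
        exact absurd hxy (by decide))
    refine ⟨x, Or.inl ?_⟩
    rw [hc.cycSum_eq, h0, hx1 z (by simp) rfl, hx2 w (by simp) (Ne.symm hzw)]
    decide
  all_goals
    obtain ⟨x, -, -, hx2⟩ := hE.exists_above {z, w} ∅ (by simp)
    refine ⟨x, Or.inl ?_⟩
    rw [hc.cycSum_eq, h0, hx2 z (by simp) (by simp), hx2 w (by simp) (by simp)]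
    decide

theorem cycSign_eq (hE : HasExt (ordCode (P := P)))
    (hf : ∀ a b c, cycSum ordCode (f a) (f b) (f c) = 0 ↔ cycSum ordCode a b c = 0)
    {z x y z' x' y' : P} (h : cycSum ordCode z x y ≠ 0) (h₂ : cycSum ordCode z' x' y' ≠ 0) :
    cycSign f z x y = cycSign f z' x' y' := by
  obtain ⟨w, hw | rfl⟩ := exists_cycSum_ne_zero hE z z'
  · rw [cycSign_eq_of_common hE hf h hw, ← cycSign_rotate z]
    refine cycSign_eq_of_common hE hf ?_ h₂
    rwa [cycSum_rotate]
  · exact cycSign_eq_of_common hE hf h h₂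

/-- A permutation preserving the zero triangles preserves or negates all triangle sums. -/
theorem cycSum_eq_or_eq_neg (hE : HasExt (ordCode (P := P)))
    (hf : ∀ a b c, cycSum ordCode (f a) (f b) (f c) = 0 ↔ cycSum ordCode a b c = 0) :
    (∀ a b c, cycSum ordCode (f a) (f b) (f c) = cycSum ordCode a b c) ∨
      ∀ a b c, cycSum ordCode (f a) (f b) (f c) = -cycSum ordCode a b c := by
  have e1 : ∀ u v : ZMod 3, u * v = 1 → v = u := by decide
  have e2 : ∀ u v : ZMod 3, u ≠ 0 → (v = 0 ↔ u = 0) → u * v ≠ 1 → v = -u := by decide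
  by_cases h : ∃ a b c : P, cycSign f a b c = 1
  · obtain ⟨a, b, c, h⟩ := h
    refine Or.inl fun x y z => ?_
    by_cases h0 : cycSum ordCode x y z = 0
    · rw [(hf _ _ _).2 h0, h0]
    · refine e1 _ _ ((cycSign_eq hE hf h0 fun h1 => ?_).trans h)
      rw [cycSign, h1, zero_mul] at h
      exact absurd h (by decide)
  · push Not at h
    refine Or.inr fun x y z => ?_
    by_cases h0 : cycSum ordCode x y z = 0
    · rw [(hf _ _ _).2 h0, h0, neg_zero]
    · exact e2 _ _ h0 (hf x y z) (h x y z)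

theorem preserves3_pari_iff : Preserves3 f Pari ↔
    ∀ a b c, cycSum ordCode (f a) (f b) (f c) = 0 ↔ cycSum ordCode a b c = 0 := by
  have hc := isPosCode_ordCode (P := P)
  have h0 : ∀ a b c : P, ¬ (a ≠ b ∧ b ≠ c ∧ a ≠ c) → cycSum ordCode a b c = 0 := by
    intro a b c h
    by_contra h'
    exact h (cycSum_ne_zero_ne h')
  have hinj : ∀ a b c : P, (f a ≠ f b ∧ f b ≠ f c ∧ f a ≠ f c) ↔ (a ≠ b ∧ b ≠ c ∧ a ≠ c) := by
    simp
  refine forall₃_congr fun a b c => ?_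
  by_cases h : a ≠ b ∧ b ≠ c ∧ a ≠ c
  · have h' := (hinj a b c).2 h
    rw [pari_iff h.1 h.2.1 h.2.2, pari_iff h'.1 h'.2.1 h'.2.2]
    tauto
  · have h' := mt (hinj a b c).1 h
    exact iff_of_true (iff_of_false (mt Pari.ne h) (mt Pari.ne h'))
      (iff_of_true (h0 _ _ _ h') (h0 _ _ _ h))

end Sign

namespace IsTurnGroup

variable {G : Subgroup (Equiv.Perm P)} {I J : Type} {κ κ' κ'' : I → I → ZMod 3}

theorem hasExt (hG : IsTurnGroup G) : HasExt (ordCode (P := P)) :=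
  hasExt_ordCode hG.universal hG.homogeneous

theorem mem_of_forall_preserves3 (hG : IsTurnGroup G) (hP : ∀ g ∈ G, Preserves3 g Pari)
    (hne : ∃ f ∈ G, ¬ IsRotation f) {f : Equiv.Perm P} (hf : Preserves3 f Pari) : f ∈ G := by
  obtain ⟨g, hg, hgr⟩ := hne
  rcases cycSum_eq_or_eq_neg hG.hasExt (preserves3_pari_iff.1 hf) with h | h
  · exact hG.rotation_mem _ (isRotation_of_cycSum h)
  rcases cycSum_eq_or_eq_neg hG.hasExt (preserves3_pari_iff.1 (hP g hg)) with h' | h'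
  · exact absurd (isRotation_of_cycSum h') hgr
  have : f * g⁻¹ ∈ G := by
    refine hG.rotation_mem _ (isRotation_of_cycSum fun x y z => ?_)
    have := h' (g⁻¹ x) (g⁻¹ y) (g⁻¹ z)
    simp only [← Equiv.Perm.mul_apply, mul_inv_cancel, Equiv.Perm.one_apply] at this
    rw [Equiv.Perm.mul_apply, Equiv.Perm.mul_apply, Equiv.Perm.mul_apply, h, this]
  simpa using G.mul_mem this hg

theorem exists_eq_add_sub_of_cycSum {κ' : I → I → ZMod 3} (h : IsPosCode κ) (h' : IsPosCode κ')
    (hc : ∀ x y z, cycSum κ' x y z = cycSum κ x y z) :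
    ∃ φ : I → ZMod 3, ∀ i j, κ' i j = κ i j + φ i - φ j := by
  rcases isEmpty_or_nonempty I with hI | ⟨⟨p⟩⟩
  · exact ⟨fun _ => 0, fun i => hI.elim i⟩
  · refine ⟨fun x => κ' x p - κ x p, fun x y => ?_⟩
    have := hc x y p
    unfold cycSum at this
    rw [h.swap x p, h'.swap x p] at this
    linear_combination this

theorem _root_.IsPosCode.neg (h : IsPosCode κ) : IsPosCode fun i j => -κ i j where
  self i := by rw [h.self, neg_zero]
  swap i j := by rw [h.swap]
  trans i j k h1 h2 := by
    rw [← h.swap] at *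
    exact h.trans _ _ _ h2 h1

theorem mem_of_forall_codeEquiv_neg (hG : IsTurnGroup G)
    (hR : ∀ (I : Type) [Finite I] (ρ : I → I → ZMod 3), IsPosCode ρ →
      CodeEquiv G ρ fun i j => -ρ i j)
    {f : Equiv.Perm P} (hf : Preserves3 f Pari) : f ∈ G := by
  rcases cycSum_eq_or_eq_neg hG.hasExt (preserves3_pari_iff.1 hf) with h | h
  · exact hG.rotation_mem _ (isRotation_of_cycSum h)
  refine hG.mem_of_forall_codeEquiv fun I _ a ha => ?_
  have h1 := isPosCode_ordCode.comap a
  have h2 := isPosCode_ordCode.comap (f ∘ a)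
  obtain ⟨φ, hφ⟩ := exists_eq_add_sub_of_cycSum h1.neg h2 fun x y z => by
    have := h (a x) (a y) (a z)
    unfold cycSum at *
    simp only [Function.comp_apply]
    rw [this]
    ring
  exact hG.codeEquiv_trans (hR I _ h1) (hG.codeEquiv_of_eq_add_sub h1.neg h2 φ hφ)

end IsTurnGroup

/-- Finite Ramsey theorem for pairs of tuples drawn from consecutive blocks. -/
theorem exists_homogeneous_blocks {K : Type} [Finite K] [Nonempty K] (N L : ℕ)
    (F : (Fin N → ℕ) → (Fin N → ℕ) → K) :
    ∃ (c : K) (ψ : Fin N → ℕ → ℕ), (∀ i p q, p < q → q < L → ψ i p < ψ i q) ∧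
      ∀ u v : Fin N → ℕ, (∀ i, u i < v i) → (∀ i, v i < L) →
        F (fun i => ψ i (u i)) (fun i => ψ i (v i)) = c := by
  obtain ⟨c, φ, hφ, h⟩ := exists_homogeneous_tuples (2 * N) (N * L) fun s =>
    F (fun i => s ⟨2 * i, by omega⟩) (fun i => s ⟨2 * i + 1, by omega⟩)
  have hlt : ∀ (i : Fin N) (p : ℕ), p < L → i * L + p < N * L := fun i p hp =>
    calc i * L + p < i * L + L := by omega
      _ = (i + 1) * L := by ring
      _ ≤ N * L := Nat.mul_le_mul_right _ i.2
  refine ⟨c, fun i p => if hp : p < L then φ ⟨i * L + p, hlt i p hp⟩ else 0, ?_, ?_⟩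
  · intro i p q hpq hq
    beta_reduce
    rw [dif_pos hq, dif_pos (hpq.trans hq)]
    exact hφ (Fin.mk_lt_mk.2 (by omega))
  · intro u v huv hv
    have hu : ∀ i, u i < L := fun i => (huv i).trans (hv i)
    let w : Fin (2 * N) → ℕ := fun k =>
      if k.1 % 2 = 0 then u ⟨k.1 / 2, by omega⟩ else v ⟨k.1 / 2, by omega⟩
    have hw : ∀ k, w k < L := fun k => by
      simp only [w]; split_ifs
      exacts [hu _, hv _]
    let s : Fin (2 * N) → Fin (N * L) := fun k =>
      ⟨(k.1 / 2) * L + w k, hlt ⟨k.1 / 2, by omega⟩ _ (hw k)⟩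
    have hs : StrictMono s := by
      intro k l hkl
      rw [Fin.mk_lt_mk]
      have hkl' : k.1 < l.1 := hkl
      by_cases hd : k.1 / 2 = l.1 / 2
      · have e1 : k.1 % 2 = 0 := by omega
        have e2 : l.1 % 2 ≠ 0 := by omega
        simp only [w, if_pos e1, if_neg e2, hd]
        exact Nat.add_lt_add_left (huv _) _
      · have : k.1 / 2 + 1 ≤ l.1 / 2 := by omega
        calc (k.1 / 2) * L + w k < (k.1 / 2) * L + L := Nat.add_lt_add_left (hw k) _
          _ = (k.1 / 2 + 1) * L := by ring
          _ ≤ (l.1 / 2) * L := Nat.mul_le_mul_right _ this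
          _ ≤ _ := Nat.le_add_right _ _
    have := h s hs
    rw [← this]
    congr 1 <;> funext i
    · beta_reduce
      rw [dif_pos (hu i)]
      simp only [Function.comp_apply, s, w]
      congr 2
      rw [if_pos (by omega)]
      simp
    · beta_reduce
      rw [dif_pos (hv i)]
      simp only [Function.comp_apply, s, w]
      congr 2
      have e : (2 * i.1 + 1) / 2 = i.1 := by omega
      rw [if_neg (by omega)]
      simp only [e]

section Canonization

variable {G : Subgroup (Equiv.Perm P)} {I J : Type} {κ κ' : I → I → ZMod 3}

/-- The orders of the images of a finite partial order are given by `ε₁` and `ε₂`, with the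
uniform position `t` over `I`. -/
def Canonizes (G : Subgroup (Equiv.Perm P)) (κ κ' : I → I → ZMod 3) (ε₁ ε₂ : ZMod 3)
    (t : I → ZMod 3) (J : Type) [PartialOrder J] (rank : J → ℕ) : Prop :=
  ∃ μ : I ⊕ J → I ⊕ J → ZMod 3, CodeEquiv G (sumCode κ ordCode) μ ∧
    (∀ i j, μ (.inl i) (.inl j) = κ' i j) ∧ (∀ i r, μ (.inl i) (.inr r) = t i) ∧
    ∀ r s, rank r < rank s →
      (r < s → μ (.inr r) (.inr s) = ε₁) ∧ (¬ r < s → μ (.inr r) (.inr s) = ε₂)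

theorem IsTurnGroup.exists_canonizes [Finite I] [Finite J] [PartialOrder J]
    (hG : IsTurnGroup G) (h : CodeEquiv G κ κ') {rank : J → ℕ}
    (hinj : Function.Injective rank) (hmono : StrictMono rank) :
    ∃ ε₁ ε₂ t, Canonizes G κ κ' ε₁ ε₂ t J rank := by
  classical
  have := Fintype.ofFinite J
  obtain ⟨N, hN⟩ := exists_blocks_constant (ZMod 3 × (I → ZMod 3)) J
  have hcount := hG.countable
  obtain ⟨f, hf, hfc⟩ := exists_embedding_of_hasExt
    (h.isPosCode_left.sumCode (isPosCode_ordCode (P := Fin N → ℕ)))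
    isPosCode_ordCode hG.hasExt
  obtain ⟨g, hg, hgc⟩ := hG.exists_mem_of_codeEquiv h (a := fun i => f (.inl i))
    (hf.comp Sum.inl_injective) fun i j => hfc _ _
  obtain ⟨m, hm⟩ : ∃ m, ∀ r, rank r < m :=
    ⟨∑ r, (rank r + 1), fun r => Nat.lt_of_lt_of_le (Nat.lt_succ_self _)
      (Finset.single_le_sum (f := fun r => rank r + 1) (by simp) (Finset.mem_univ r))⟩
  let F : (Fin N → ℕ) → (Fin N → ℕ) → (Fin N → Bool) → ZMod 3 × (I → ZMod 3) := fun u v σ =>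
    (ordCode (g (f (.inr fun i => if σ i then v i else u i)))
      (g (f (.inr fun i => if σ i then u i else v i))),
      fun i => ordCode (g (f (.inl i))) (g (f (.inr fun i => if σ i then v i else u i))))
  obtain ⟨c, ψ, hψ, hc⟩ := exists_homogeneous_blocks N (2 * (2 * m)) F
  obtain ⟨τ, k, hτ, hk⟩ := hN c
  let off : Fin N → J → ℕ := fun i r =>
    2 * (rank r + (τ i).elim 0 fun b => if r ≤ b then 0 else m)
  have hoff : ∀ i r, off i r + 1 < 2 * (2 * m) := by
    intro i r
    have : (τ i).elim 0 (fun b => if r ≤ b then 0 else m) ≤ m := by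
      rcases τ i with _ | b
      · simp
      · simp only [Option.elim_some]; split_ifs <;> omega
    have := hm r
    simp only [off]; omega
  let e : J → Fin N → ℕ := fun r i => ψ i (off i r)
  have hte : ∀ i r, ordCode (g (f (.inl i))) (g (f (.inr (e r)))) = (c fun _ => false).2 i := by
    intro i r
    rw [← hc (fun i => off i r) (fun i => off i r + 1) (fun _ => Nat.lt_succ_self _)
      (fun i => hoff i r)]
    simp [F, e]
  let T : J → J → J → Bool := fun r s b => decide (s ≤ b ∧ ¬ r ≤ b)
  have hT : ∀ r s i, rank r < rank s →
      ((τ i).elim false (T r s) = true → off i s < off i r) ∧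
      ((τ i).elim false (T r s) = false → off i r < off i s) := by
    intro r s i hrs
    have h1 := hm s
    simp only [off]
    rcases τ i with _ | b
    · simp; omega
    · simp only [Option.elim_some, T, decide_eq_true_eq, decide_eq_false_iff_not]
      split_ifs <;> constructor <;> intro hh <;> first | omega | tauto
  have hpair : ∀ r s, rank r < rank s →
      ordCode (g (f (.inr (e r)))) (g (f (.inr (e s)))) =
        (c fun i => (τ i).elim false (T r s)).1 := by
    intro r s hrs
    rw [← hc (fun i => min (off i r) (off i s)) (fun i => max (off i r) (off i s)) ?_ ?_]
    · simp only [F]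
      congr 4 <;> funext i <;> split_ifs with hh <;> simp only [e]
      · rw [max_eq_left ((hT r s i hrs).1 hh).le]
      · rw [min_eq_left ((hT r s i hrs).2 (by simpa using hh)).le]
      · rw [min_eq_right ((hT r s i hrs).1 hh).le]
      · rw [max_eq_right ((hT r s i hrs).2 (by simpa using hh)).le]
    · intro i
      rcases hh : (τ i).elim false (T r s) with _ | _
      · have := (hT r s i hrs).2 hh; omega
      · have := (hT r s i hrs).1 hh; omega
    · intro i
      have := hoff i r; have := hoff i s; omega
  have hne : ∀ r s, ¬ r ≤ s → rank r < rank s → ∃ b, T r s b = true := fun r s h _ =>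
    ⟨s, by simp [T, h]⟩
  have helt : ∀ r s, r < s → e r < e s := by
    intro r s hrs
    have h1 : ∀ i, e r i < e s i := by
      intro i
      refine hψ i _ _ ((hT r s i (hmono hrs)).2 ?_) ((Nat.lt_succ_self _).trans (hoff i s))
      rcases τ i with _ | b
      · rfl
      · simp only [Option.elim_some, T, decide_eq_false_iff_not]
        exact fun hh => hh.2 (hrs.le.trans hh.1)
    obtain ⟨i, -⟩ := hτ r
    exact lt_of_le_of_ne (fun i => (h1 i).le) fun h => (h1 i).ne (congrFun h i)
  have hele : ∀ r s, e r ≤ e s → r ≤ s := by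
    intro r s hrs
    by_contra hn
    rcases lt_trichotomy (rank r) (rank s) with hr | hr | hr
    · obtain ⟨i, hi⟩ := hτ s
      refine absurd (hrs i) (not_le.2 (hψ i _ _ ((hT r s i hr).1 ?_)
        ((Nat.lt_succ_self _).trans (hoff i r))))
      simp [hi, T, hn]
    · exact hn (hinj hr).le
    · by_cases hsr : s ≤ r
      · exact absurd hrs (helt s r (lt_of_le_of_ne hsr fun h => hn h.ge)).not_ge
      · obtain ⟨i, hi⟩ := hτ s
        refine absurd (hrs i) (not_le.2 (hψ i _ _ ((hT s r i hr).2 ?_)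
          ((Nat.lt_succ_self _).trans (hoff i r))))
        simp [hi, T]
  have heinj : Function.Injective e := fun r s h => le_antisymm (hele r s h.le) (hele s r h.ge)
  have heo : ∀ r s, ordCode (e r) (e s) = ordCode r s := fun r s => by
    have key : ∀ r s, e r < e s ↔ r < s := fun r s =>
      ⟨fun h => lt_of_le_of_ne (hele r s h.le) fun h' => h.ne (congrArg e h'), helt r s⟩
    exact ordCode_eq_iff.2 ⟨key r s, key s r⟩
  refine ⟨(c fun _ => false).1, k.1, (c fun _ => false).2,
    fun x y => ordCode (g (f (Sum.map id e x))) (g (f (Sum.map id e y))),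
    ⟨fun x => f (Sum.map id e x), hf.comp (Function.injective_id.sumMap heinj), ?_, g, hg,
      fun _ _ => rfl⟩, hgc, hte, fun r s hrs => ⟨fun h => ?_, fun h => ?_⟩⟩
  · intro x y
    rw [hfc]
    rcases x with x | x <;> rcases y with y | y <;> first | rfl | exact heo _ _
  · refine (hpair r s hrs).trans ?_
    congr 2
    funext i
    rcases τ i with _ | b
    · rfl
    · simp only [Option.elim_some, T, decide_eq_false_iff_not]
      exact fun hh => hh.2 (h.le.trans hh.1)
  · refine (hpair r s hrs).trans ?_
    rw [hk _ (hne r s (fun h' => h (lt_of_le_of_ne h' fun h'' => hrs.ne (congrArg rank h''))) hrs)]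

end Canonization

section Canonization

variable {G : Subgroup (Equiv.Perm P)} {I J J' : Type} {κ κ' : I → I → ZMod 3}

theorem Canonizes.comap [PartialOrder J] [PartialOrder J'] {ε₁ ε₂ : ZMod 3} {t : I → ZMod 3}
    {rank : J → ℕ} {rank' : J' → ℕ} (h : Canonizes G κ κ' ε₁ ε₂ t J' rank') {f : J → J'}
    (hf : Function.Injective f) (hlt : ∀ r s, f r < f s ↔ r < s)
    (hr : ∀ r s, rank r < rank s → rank' (f r) < rank' (f s)) :
    Canonizes G κ κ' ε₁ ε₂ t J rank := by
  obtain ⟨μ, hμ, h1, h2, h3⟩ := h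
  refine ⟨fun x y => μ (Sum.map id f x) (Sum.map id f y), ?_, h1, fun i r => h2 i (f r),
    fun r s hrs => ?_⟩
  · have := hμ.comap (f := Sum.map id f) (Function.injective_id.sumMap hf)
    convert this using 3 with x y
    rcases x with x | x <;> rcases y with y | y <;> try rfl
    exact (ordCode_eq_iff.2 ⟨hlt _ _, hlt _ _⟩).symm
  · have := h3 _ _ (hr r s hrs)
    rwa [hlt] at this

theorem IsTurnGroup.exists_uniform_canonizes [Finite I] (hG : IsTurnGroup G)
    (h : CodeEquiv G κ κ') :
    ∃ ε₁ ε₂ t, ∀ (J : Type) [PartialOrder J] [Finite J] (rank : J → ℕ),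
      Function.Injective rank → StrictMono rank → Canonizes G κ κ' ε₁ ε₂ t J rank := by
  classical
  have := Fintype.ofFinite I
  let O := ZMod 3 × ZMod 3 × (I → ZMod 3)
  suffices hO : ∃ o : O, ∀ (J : Type) [PartialOrder J] [Finite J] (rank : J → ℕ),
      Function.Injective rank → StrictMono rank →
        Canonizes G κ κ' o.1 o.2.1 o.2.2 J rank from
    let ⟨o, ho⟩ := hO
    ⟨o.1, o.2.1, o.2.2, ho⟩
  by_contra! hcon
  choose J hJ hfin rank hinj hmono hbad using hcon
  let idx := Fintype.equivFin O
  let R : (Σ o, J o) → ℕ := fun x => rank x.1 x.2 * Fintype.card O + idx x.1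
  have hdiv : ∀ x, R x / Fintype.card O = rank x.1 x.2 := fun x => by
    have := (idx x.1).2
    simp only [R]
    rw [Nat.mul_comm, Nat.mul_add_div (by omega), Nat.div_eq_of_lt this, add_zero]
  have hmod : ∀ x, R x % Fintype.card O = idx x.1 := fun x => by
    simp only [R]
    rw [Nat.mul_comm, Nat.mul_add_mod, Nat.mod_eq_of_lt (idx x.1).2]
  obtain ⟨ε₁, ε₂, t, ht⟩ := hG.exists_canonizes h (J := Σ o, J o) (rank := R) (by
    rintro ⟨o, r⟩ ⟨o', r'⟩ hR
    have h1 := hmod ⟨o, r⟩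
    rw [hR, hmod ⟨o', r'⟩] at h1
    obtain rfl : o' = o := idx.injective (Fin.ext h1)
    have h2 := hdiv ⟨o', r⟩
    rw [hR, hdiv ⟨o', r'⟩] at h2
    rw [show r = r' from (hinj o' h2).symm]) (by
    rintro ⟨o, r⟩ ⟨o', r'⟩ hlt
    cases hlt with
    | fiber _ _ _ hlt =>
      have := hmono o hlt
      exact Nat.add_lt_add_right (Nat.mul_lt_mul_of_pos_right this (Fin.pos (idx o))) _)
  refine hbad (ε₁, ε₂, t) (ht.comap (f := Sigma.mk _) sigma_mk_injective (fun r s => ?_)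
    fun r s hrs => ?_)
  · exact Sigma.mk_lt_mk_iff
  · exact Nat.add_lt_add_right (Nat.mul_lt_mul_of_pos_right hrs (Fin.pos (idx (ε₁, ε₂, t)))) _

theorem exists_injective_strictMono_nat (J : Type) [PartialOrder J] [Finite J] :
    ∃ rank : J → ℕ, Function.Injective rank ∧ StrictMono rank := by
  classical
  have : Fintype (LinearExtension J) := Fintype.ofFinite J
  let e := Fintype.orderIsoFinOfCardEq (LinearExtension J) rfl
  have hinj : Function.Injective fun r : J => (e.symm (toLinearExtension r)).1 := fun r s h =>
    e.symm.injective (Fin.ext h)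
  refine ⟨_, hinj, Monotone.strictMono_of_injective (fun r s h => ?_) hinj⟩
  exact e.symm.monotone (toLinearExtension.monotone h)

theorem IsPosCode.ordCode_toPartialOrder {ρ : J → J → ZMod 3} (h : IsPosCode ρ) :
    @ordCode J h.toPartialOrder = ρ := by
  let _ := h.toPartialOrder
  have key : ∀ i j : J, i < j ↔ ρ i j = 1 := fun i j => by
    refine lt_iff_le_and_ne.trans ⟨fun hij => hij.1.resolve_left hij.2, fun hij =>
      ⟨Or.inr hij, ?_⟩⟩
    rintro rfl
    rw [h.self] at hij
    exact absurd hij (by decide)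
  funext i j
  rcases ZMod3_cases (ρ i j) with h0 | h0 | h0
  · rw [h0]
    by_contra hne
    rcases ZMod3_cases (ordCode i j) with h1 | h1 | h1
    · exact hne h1
    · rw [ordCode_eq_one, key, h0] at h1
      exact absurd h1 (by decide)
    · rw [ordCode_eq_neg_one, key, h.swap, h0] at h1
      exact absurd h1 (by decide)
  · rw [h0, ordCode_eq_one, key, h0]
  · rw [h0, ordCode_eq_neg_one, key, h.swap, h0, neg_neg]

/-- Any two codes on at most `k` points are equivalent. -/
def AllCodeEquiv (G : Subgroup (Equiv.Perm P)) (k : ℕ) : Prop :=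
  ∀ (I : Type) [Finite I], Nat.card I ≤ k → ∀ κ ρ : I → I → ZMod 3, IsPosCode κ →
    IsPosCode ρ → CodeEquiv G κ ρ

/-- The code of the antichain. -/
theorem isPosCode_zero : IsPosCode fun _ _ : I => (0 : ZMod 3) where
  self _ := rfl
  swap _ _ := neg_zero.symm
  trans _ _ _ h := absurd h (by decide)

theorem IsTurnGroup.mem_of_forall_allCodeEquiv (hG : IsTurnGroup G) (h : ∀ k, AllCodeEquiv G k)
    (f : Equiv.Perm P) : f ∈ G :=
  hG.mem_of_forall_codeEquiv fun I _ a _ => h (Nat.card I) I le_rfl _ _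
    (isPosCode_ordCode.comap a) (isPosCode_ordCode.comap (f ∘ a))

theorem IsTurnGroup.strongEquiv_or [Finite I] (hG : IsTurnGroup G) (h : CodeEquiv G κ κ') :
    (∃ (κ'' : I → I → ZMod 3) (φ : I → ZMod 3), IsPosCode κ'' ∧
      (∀ i j, κ'' i j = κ' i j + φ i - φ j) ∧ StrongEquiv G κ κ'') ∨
    (∀ (J : Type) [Finite J] (ρ : J → J → ZMod 3), IsPosCode ρ →
      CodeEquiv G ρ fun i j => -ρ i j) ∨
    ∀ k, AllCodeEquiv G k := by
  obtain ⟨ε₁, ε₂, t, ht⟩ := hG.exists_uniform_canonizes h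
  have main : ∀ (J : Type) [Finite J] (ρ : J → J → ZMod 3), IsPosCode ρ →
      ∀ rank : J → ℕ, Function.Injective rank → (∀ r s, ρ r s = 1 → rank r < rank s) →
      ∃ μ : I ⊕ J → I ⊕ J → ZMod 3, CodeEquiv G (sumCode κ ρ) μ ∧
        (∀ i j, μ (.inl i) (.inl j) = κ' i j) ∧ (∀ i r, μ (.inl i) (.inr r) = t i) ∧
        ∀ r s, rank r < rank s →
          (ρ r s = 1 → μ (.inr r) (.inr s) = ε₁) ∧ (ρ r s ≠ 1 → μ (.inr r) (.inr s) = ε₂) := by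
    intro J _ ρ hρ rank hinj hmono
    let _ := hρ.toPartialOrder
    have hlt : ∀ r s : J, r < s ↔ ρ r s = 1 := fun r s => by
      rw [← ordCode_eq_one, hρ.ordCode_toPartialOrder]
    obtain ⟨μ, h1, h2, h3, h4⟩ := ht J rank hinj fun r s h => hmono r s ((hlt r s).1 h)
    rw [hρ.ordCode_toPartialOrder] at h1
    simp only [hlt] at h4
    exact ⟨μ, h1, h2, h3, h4⟩
  have exists_rank : ∀ (J : Type) [Finite J] (ρ : J → J → ZMod 3), IsPosCode ρ →
      ∃ rank : J → ℕ, Function.Injective rank ∧ ∀ r s, ρ r s = 1 → rank r < rank s := by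
    intro J _ ρ hρ
    let _ := hρ.toPartialOrder
    obtain ⟨rank, h1, h2⟩ := exists_injective_strictMono_nat J
    refine ⟨rank, h1, fun r s h => h2 ?_⟩
    rwa [← ordCode_eq_one, hρ.ordCode_toPartialOrder]
  have hε : ε₂ = 0 ∨ ε₁ = ε₂ := by
    let ρ : Fin 3 → Fin 3 → ZMod 3 := ![![0, 0, 1], ![0, 0, 0], ![-1, 0, 0]]
    have hρ : IsPosCode ρ := ⟨by decide, by decide, by decide⟩
    obtain ⟨μ, h1, -, -, h4⟩ := main (Fin 3) ρ hρ Fin.val Fin.val_injective (by decide)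
    have e1 := (h4 0 1 (by decide)).2 (by decide)
    have e2 := (h4 1 2 (by decide)).2 (by decide)
    have e3 := (h4 0 2 (by decide)).1 (by decide)
    have hv := h1.isPosCode_right.validTriple (.inr 0) (.inr 1) (.inr 2)
    rw [e1, e2, e3] at hv
    clear e1 e2 e3 h4 h1 μ main ht
    revert ε₁ ε₂
    decide
  by_cases hee : ε₁ = ε₂
  · right; right
    subst hee
    have key : ∀ (J : Type) [Finite J] (ρ : J → J → ZMod 3), IsPosCode ρ →
        CodeEquiv G ρ fun _ _ => 0 := by
      intro J _ ρ hρ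
      obtain ⟨rank, h1, h2⟩ := exists_rank J ρ hρ
      obtain ⟨μ, hμ, -, -, h4⟩ := main J ρ hρ rank h1 h2
      obtain ⟨μ', hμ', -, -, h4'⟩ := main J _ isPosCode_zero rank h1 (by
        intro r s h; exact absurd h (by decide))
      have e : ∀ r s, μ (.inr r) (.inr s) = μ' (.inr r) (.inr s) := by
        have key : ∀ r s, rank r < rank s → μ (.inr r) (.inr s) = μ' (.inr r) (.inr s) := by
          intro r s hrs
          rw [(h4' r s hrs).2 (by decide)]
          by_cases hr : ρ r s = 1
          exacts [(h4 r s hrs).1 hr, (h4 r s hrs).2 hr]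
        intro r s
        rcases lt_trichotomy (rank r) (rank s) with h | h | h
        · exact key r s h
        · rw [h1 h, hμ.isPosCode_right.self, hμ'.isPosCode_right.self]
        · rw [hμ.isPosCode_right.swap (.inr s), hμ'.isPosCode_right.swap (.inr s), key s r h]
      have c1 := hμ.comap (f := Sum.inr) Sum.inr_injective
      have c2 := hμ'.comap (f := Sum.inr) Sum.inr_injective
      simp only [e] at c1
      exact hG.codeEquiv_trans c1 c2.symm
    intro k J _ _ ρ ρ' hρ hρ'
    exact hG.codeEquiv_trans (key J ρ hρ) (key J ρ' hρ').symm
  obtain rfl : ε₂ = 0 := hε.resolve_right hee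
  have image_eq : ∀ (J : Type) [Finite J] (ρ : J → J → ZMod 3), IsPosCode ρ →
      ∃ μ : I ⊕ J → I ⊕ J → ZMod 3, CodeEquiv G (sumCode κ ρ) μ ∧
        (∀ i j, μ (.inl i) (.inl j) = κ' i j) ∧ (∀ i r, μ (.inl i) (.inr r) = t i) ∧
        ∀ r s, μ (.inr r) (.inr s) = ε₁ * ρ r s := by
    intro J _ ρ hρ
    obtain ⟨rank, h1, h2⟩ := exists_rank J ρ hρ
    obtain ⟨μ, hμ, h3, h4, h5⟩ := main J ρ hρ rank h1 h2
    refine ⟨μ, hμ, h3, h4, ?_⟩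
    have key : ∀ r s, rank r < rank s → μ (.inr r) (.inr s) = ε₁ * ρ r s := by
      intro r s hrs
      rcases ZMod3_cases (ρ r s) with h | h | h
      · rw [(h5 r s hrs).2 (by rw [h]; decide), h, mul_zero]
      · rw [(h5 r s hrs).1 h, h, mul_one]
      · refine absurd (h2 s r ?_) hrs.not_gt
        rw [hρ.swap, h, neg_neg]
    intro r s
    rcases lt_trichotomy (rank r) (rank s) with h | h | h
    · exact key r s h
    · rw [h1 h, hμ.isPosCode_right.self, hρ.self, mul_zero]
    · rw [hμ.isPosCode_right.swap (.inr s), key s r h, hρ.swap s r]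
      ring
  rcases ZMod3_cases ε₁ with rfl | rfl | rfl
  · exact absurd rfl hee
  · left
    obtain ⟨μ, hμ, h1, h2, -⟩ := image_eq Unit _ isPosCode_zero
    have hμr := hμ.isPosCode_right
    have hκ : ∀ i j, rotCode μ (.inr ()) (.inl i) (.inl j) = κ' i j + -t i - -t j := by
      intro i j
      rw [rotCode, h1, hμr.swap (.inl i) (.inr ()), hμr.swap (.inl j) (.inr ()), h2, h2]
      ring
    refine ⟨fun i j => rotCode μ (.inr ()) (.inl i) (.inl j), fun i => -t i,
      (hμr.rotCode (.inr ())).comap _, hκ, fun J _ ρ hρ => ?_⟩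
    obtain ⟨ν, hν, h1', h2', h3'⟩ := image_eq J ρ hρ
    refine hG.codeEquiv_trans hν (hG.codeEquiv_of_eq_add_sub hν.isPosCode_right
      (((hμr.rotCode (.inr ())).comap _).sumCode hρ) (Sum.elim (fun i => -t i) fun _ => 0) ?_)
    rintro (i | r) (j | s)
    · simp [sumCode, hκ, h1']
    · simp [sumCode, h2']
    · simp [sumCode, hν.isPosCode_right.swap (.inl j) (.inr r), h2']
    · simp [sumCode, h3']
  · right; left
    intro J _ ρ hρ
    obtain ⟨μ, hμ, -, -, h3⟩ := image_eq J ρ hρ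
    have := hμ.comap (f := Sum.inr) Sum.inr_injective
    simp only [h3, neg_one_mul] at this
    exact this

end Canonization

/-- Any two codes on at most `k` points are strongly equivalent. -/
def AllStrongEquiv (G : Subgroup (Equiv.Perm P)) (k : ℕ) : Prop :=
  ∀ (I : Type) [Finite I], Nat.card I ≤ k → ∀ κ ρ : I → I → ZMod 3, IsPosCode κ →
    IsPosCode ρ → StrongEquiv G κ ρ

/-- Every equivalence of codes is strong, up to a change of levels. -/
def HasStrengthening (G : Subgroup (Equiv.Perm P)) : Prop :=
  ∀ (I : Type) [Finite I] (κ κ' : I → I → ZMod 3), CodeEquiv G κ κ' →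
    ∃ (κ'' : I → I → ZMod 3) (φ : I → ZMod 3), IsPosCode κ'' ∧
      (∀ i j, κ'' i j = κ' i j + φ i - φ j) ∧ StrongEquiv G κ κ''

section Modules

variable {G : Subgroup (Equiv.Perm P)} {I J K : Type} {k : ℕ}

/-- Replacing the code of a small set that is homogeneous up to a change of levels. -/
theorem AllStrongEquiv.codeEquiv [Finite K] (hS : AllStrongEquiv G k) (hG : IsTurnGroup G)
    {l l' : K → K → ZMod 3} (hl : IsPosCode l) (hl' : IsPosCode l') (M : Set K)
    (hM : M.ncard ≤ k) (φ φ' : K → ZMod 3)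
    (h : ∀ m ∈ M, ∀ x ∉ M, l m x + φ m - φ x = 0)
    (h' : ∀ m ∈ M, ∀ x ∉ M, l' m x + φ' m - φ' x = 0)
    (he : ∀ x ∉ M, ∀ y ∉ M, l x y + φ x - φ y = l' x y + φ' x - φ' y) :
    CodeEquiv G l l' := by
  classical
  rcases M.eq_empty_or_nonempty with rfl | ⟨m₀, hm₀⟩
  · refine hG.codeEquiv_of_eq_add_sub hl hl' (fun x => φ x - φ' x) fun x y => ?_
    have := he x (by simp) y (by simp)
    linear_combination -this
  rcases Mᶜ.eq_empty_or_nonempty with hMc | ⟨x₀, hx₀⟩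
  · rw [Set.compl_empty_iff] at hMc
    rw [hMc, Set.ncard_univ] at hM
    exact (hS K hM l l' hl hl').codeEquiv
  have key : ∀ (l : K → K → ZMod 3) (φ : K → ZMod 3), IsPosCode l →
      (∀ m ∈ M, ∀ x ∉ M, l m x + φ m - φ x = 0) →
      IsPosCode (fun m m' : M => l m m' + φ m - φ m') ∧
      IsPosCode (fun x y : (Mᶜ : Set K) => l x y + φ x - φ y) := by
    intro l φ hl h
    have e1 := (hl.rotCode x₀).comap fun m : M => m.1
    have e2 := (hl.rotCode m₀).comap fun x : (Mᶜ : Set K) => x.1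
    constructor
    · convert e1 using 3 with m m'
      have h1 := h m m.2 x₀ hx₀
      have h2 := h m' m'.2 x₀ hx₀
      rw [rotCode]
      linear_combination h1 - h2 - hl.swap m x₀ + hl.swap m' x₀
    · convert e2 using 3 with x y
      have h1 := h m₀ hm₀ x x.2
      have h2 := h m₀ hm₀ y y.2
      rw [rotCode]
      linear_combination h2 - h1
  obtain ⟨a1, a2⟩ := key l φ hl h
  obtain ⟨b1, b2⟩ := key l' φ' hl' h'
  have hstr := hS M (by rwa [Nat.card_coe_set_eq]) _ _ a1 b1 _ _ a2
  let e : K ≃ M ⊕ (Mᶜ : Set K) := (Equiv.Set.sumCompl M).symm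
  have hcomp : ∀ (l l₂ : K → K → ZMod 3) (φ φ₂ : K → ZMod 3), IsPosCode l →
      (∀ m ∈ M, ∀ x ∉ M, l m x + φ m - φ x = 0) →
      (∀ x ∉ M, ∀ y ∉ M, l x y + φ x - φ y = l₂ x y + φ₂ x - φ₂ y) → ∀ x y,
      sumCode (fun m m' : M => l m m' + φ m - φ m')
        (fun x y : (Mᶜ : Set K) => l₂ x y + φ₂ x - φ₂ y) (e x) (e y) = l x y + φ x - φ y := by
    intro l l₂ φ φ₂ hl h h2 x y
    by_cases hx : x ∈ M <;> by_cases hy : y ∈ M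
    · simp only [e, Equiv.Set.sumCompl_symm_apply_of_mem, hx, hy, sumCode]
    · simp only [e, Equiv.Set.sumCompl_symm_apply_of_mem,
        Equiv.Set.sumCompl_symm_apply_of_notMem, hx, hy, sumCode, not_false_eq_true]
      exact (h x hx y hy).symm
    · simp only [e, Equiv.Set.sumCompl_symm_apply_of_mem,
        Equiv.Set.sumCompl_symm_apply_of_notMem, hx, hy, sumCode, not_false_eq_true]
      have := h y hy x hx
      rw [hl.swap y x]
      linear_combination this
    · simp only [e, Equiv.Set.sumCompl_symm_apply_of_notMem, hx, hy, sumCode, not_false_eq_true]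
      exact (h2 x hx y hy).symm
  have c1 := hcomp l l φ φ hl h fun _ _ _ _ => rfl
  have c2 := hcomp l' l φ' φ hl' h' fun x hx y hy => (he x hx y hy).symm
  have hmid := hstr.comap e.injective
  refine hG.codeEquiv_trans (hG.codeEquiv_of_eq_add_sub hl hmid.isPosCode_left φ c1)
    (hG.codeEquiv_trans hmid (hG.codeEquiv_of_eq_add_sub hl' hmid.isPosCode_right φ' c2).symm)

/-- Replacing the code of a small module. -/
theorem AllStrongEquiv.strongEquiv [Finite K] (hS : AllStrongEquiv G k) (hG : IsTurnGroup G)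
    {l l' : K → K → ZMod 3} (hl : IsPosCode l) (hl' : IsPosCode l') (M : Set K)
    (hM : M.ncard ≤ k) (h : ∀ m ∈ M, ∀ m' ∈ M, ∀ x ∉ M, l m x = l m' x)
    (h' : ∀ m ∈ M, ∀ x ∉ M, l' m x = l m x) (he : ∀ x ∉ M, ∀ y ∉ M, l' x y = l x y) :
    StrongEquiv G l l' := by
  classical
  rcases M.eq_empty_or_nonempty with rfl | ⟨m₀, hm₀⟩
  · rw [show l' = l from funext₂ fun x y => he x (by simp) y (by simp)]
    exact StrongEquiv.refl hG hl
  intro J _ ρ hρ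
  let φ : K ⊕ J → ZMod 3 := Sum.elim (fun x => if x ∈ M then 0 else l m₀ x) fun _ => 0
  refine hS.codeEquiv hG (hl.sumCode hρ) (hl'.sumCode hρ) (Sum.inl '' M) ?_ φ φ ?_ ?_ ?_
  · rwa [Set.ncard_image_of_injective _ Sum.inl_injective]
  · rintro _ ⟨m, hm, rfl⟩ (x | j) hx
    · have hx' : x ∉ M := fun hx' => hx ⟨x, hx', rfl⟩
      simp [sumCode, φ, hm, hx', h m hm m₀ hm₀ x hx']
    · simp [sumCode, φ, hm]
  · rintro _ ⟨m, hm, rfl⟩ (x | j) hx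
    · have hx' : x ∉ M := fun hx' => hx ⟨x, hx', rfl⟩
      simp [sumCode, φ, hm, hx', h' m hm x hx', h m hm m₀ hm₀ x hx']
    · simp [sumCode, φ, hm]
  · rintro (x | j) hx (y | i) hy
    · rw [sumCode, sumCode, he x (fun hx' => hx ⟨x, hx', rfl⟩) y fun hy' => hy ⟨y, hy', rfl⟩]
    all_goals simp [sumCode]

theorem allStrongEquiv_of_zero (hG : IsTurnGroup G)
    (h : ∀ (I : Type) [Finite I], Nat.card I ≤ k → ∀ κ : I → I → ZMod 3, IsPosCode κ →
      StrongEquiv G κ fun _ _ => 0) : AllStrongEquiv G k :=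
  fun I _ hI κ κ' hκ hκ' => (h I hI κ hκ).trans hG (h I hI κ' hκ').symm

theorem AllStrongEquiv.codeEquiv_zero_of_card_succ [Finite I] (hS : AllStrongEquiv G k)
    (hG : IsTurnGroup G) (hI : Nat.card I = k + 1) {κ : I → I → ZMod 3} (hκ : IsPosCode κ) :
    CodeEquiv G κ fun _ _ => 0 := by
  classical
  have : Nonempty I := (Nat.card_pos_iff.1 (by omega)).1
  obtain ⟨x⟩ := this
  have hcompl : ({x}ᶜ : Set I).ncard = k := by
    rw [Set.ncard_compl, Set.ncard_singleton, hI, Nat.add_sub_cancel]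
  obtain ⟨μ, hκμ, hμ0⟩ := hG.exists_codeEquiv_extend
    (hS ({x}ᶜ : Set I) (by rw [Nat.card_coe_set_eq, hcompl]) _ _ (hκ.comap Subtype.val)
      isPosCode_zero).codeEquiv
    Subtype.val_injective hκ fun _ _ => rfl
  have hμ := hκμ.isPosCode_right
  have h0 : ∀ y z, y ≠ x → z ≠ x → μ y z = 0 := fun y z hy hz => hμ0 ⟨y, hy⟩ ⟨z, hz⟩
  refine hG.codeEquiv_trans hκμ ?_
  by_cases hex : ∃ y, y ≠ x ∧ μ x y = 0
  · obtain ⟨y, hyx, hy⟩ := hex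
    refine hS.codeEquiv hG hμ isPosCode_zero ({x} ∪ {z | μ x z ≠ 0}) ?_ (fun _ => 0) (fun _ => 0)
      ?_ ?_ ?_
    · have : ({x} ∪ {z | μ x z ≠ 0} : Set I) ⊆ {y}ᶜ := by
        rintro z (rfl | hz) rfl
        exacts [hyx rfl, hz hy]
      refine (Set.ncard_le_ncard this).trans ?_
      rw [Set.ncard_compl, Set.ncard_singleton, hI, Nat.add_sub_cancel]
    · intro m hm z hz
      simp only [Set.mem_union, Set.mem_singleton_iff, Set.mem_ofPred_eq, not_or, not_not] at hz
      rw [add_zero, sub_zero]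
      by_cases hmx : m = x
      · rw [hmx, hz.2]
      · exact h0 m z hmx hz.1
    · simp
    · intro z hz w hw
      simp only [Set.mem_union, Set.mem_singleton_iff, not_or] at hz hw
      rw [h0 z w hz.1 hw.1]
  · push Not at hex
    have e : ∀ y z, y ≠ x → z ≠ x → μ x y = μ x z := by
      intro y z hy hz
      have h1 := hex y hy
      have h2 := hex z hz
      have h3 := hμ.validTriple x y z
      rw [h0 y z hy hz] at h3
      revert h1 h2 h3
      generalize μ x y = a; generalize μ x z = b
      revert a b; decide
    have hx : ∃ ε, ∀ y, y ≠ x → μ x y = ε := by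
      by_cases hy : ∃ y, y ≠ x
      · obtain ⟨y, hy⟩ := hy
        exact ⟨μ x y, fun z hz => e z y hz hy⟩
      · push Not at hy
        exact ⟨0, fun z hz => absurd (hy z) hz⟩
    obtain ⟨ε, hε⟩ := hx
    refine hG.codeEquiv_of_eq_add_sub hμ isPosCode_zero (fun y => if y = x then -ε else 0)
      fun y z => ?_
    by_cases hy : y = x <;> by_cases hz : z = x
    · subst hy; subst hz
      simp [hμ.self]
    · subst hy
      simp [hz, hε z hz]
    · subst hz
      simp [hy, hμ.swap z y, hε y hy]
    · simp [hy, hz, h0 y z hy hz]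

end Modules

section Cones

variable {G : Subgroup (Equiv.Perm P)} {I J K : Type} {k : ℕ}

open Classical in
/-- The code `κ` modified so that the point `p` has code `ε` to all other points. -/
noncomputable def coneCode (ε : ZMod 3) (p : I) (κ : I → I → ZMod 3) (x y : I) : ZMod 3 :=
  if x = p then (if y = p then 0 else ε) else if y = p then -ε else κ x y

theorem IsPosCode.coneCode {κ : I → I → ZMod 3} (h : IsPosCode κ) {ε : ZMod 3} (hε : ε ≠ 0)
    (p : I) : IsPosCode (coneCode ε p κ) where
  self i := by
    unfold _root_.coneCode
    split_ifs <;> simp [h.self]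
  swap i j := by
    unfold _root_.coneCode
    split_ifs <;> simp [← h.swap i j]
  trans i j l := by
    have e : ∀ ε : ZMod 3, ε ≠ 0 → ε = 1 → -ε = 1 → False := by decide
    unfold _root_.coneCode
    split_ifs <;> intro h1 h2
    all_goals first
      | exact absurd h1 (by decide)
      | exact absurd h2 (by decide)
      | exact h1
      | exact h2
      | exact (e ε hε h1 h2).elim
      | exact (e ε hε h2 h1).elim
      | exact h.trans _ _ _ h1 h2

theorem levels_valid : ∀ a b c : ZMod 3, ValidTriple (a - b) (a - c) (b - c) →
    a ≠ b → a ≠ c → b = c := by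
  decide

/-- A nontrivial code with two levels is strongly equivalent to a cone over an antichain. -/
theorem AllStrongEquiv.strongEquiv_cone [Finite I] (hS : AllStrongEquiv G k) (hG : IsTurnGroup G)
    (hI : Nat.card I = k + 1) {φ : I → ZMod 3} (hφ : IsPosCode fun i j => φ i - φ j) {p q : I}
    (hpq : φ p ≠ φ q) :
    StrongEquiv G (fun i j => φ i - φ j) (coneCode (φ p - φ q) p fun _ _ => 0) := by
  classical
  have hε : φ p - φ q ≠ 0 := sub_ne_zero.2 hpq
  have hcard : ∀ x : I, ({x}ᶜ : Set I).ncard ≤ k := fun x => by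
    rw [Set.ncard_compl, Set.ncard_singleton, hI, Nat.add_sub_cancel]
  have hlev : ∀ x, φ x ≠ φ p → φ x = φ q := fun x hx => by
    have := hφ.validTriple p x q
    exact levels_valid _ _ _ this (Ne.symm hx) hpq
  have hcone := hφ.coneCode hε p
  refine StrongEquiv.trans hG (hS.strongEquiv hG hφ hcone {x | φ x = φ p} ?_ ?_ ?_ ?_)
    (hS.strongEquiv hG hcone (isPosCode_zero.coneCode hε p) {p}ᶜ (hcard p) ?_ ?_ ?_)
  · refine (Set.ncard_le_ncard (t := {q}ᶜ) ?_).trans (hcard q)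
    rintro x hx rfl
    exact hpq hx.symm
  · intro m hm m' hm' x hx
    simp only [Set.mem_ofPred_eq] at hm hm'
    rw [hm, hm']
  · intro m hm x hx
    simp only [Set.mem_ofPred_eq] at hm hx
    have hxp : x ≠ p := fun h => hx (by rw [h])
    by_cases hmp : m = p
    · simp [coneCode, hmp, hxp, hlev x hx]
    · simp [coneCode, hmp, hxp]
  · intro x hx y hy
    simp only [Set.mem_ofPred_eq] at hx hy
    have hxp : x ≠ p := fun h => hx (by rw [h])
    have hyp : y ≠ p := fun h => hy (by rw [h])
    simp [coneCode, hxp, hyp]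
  · intro m hm m' hm' x hx
    have hm : m ≠ p := hm
    have hm' : m' ≠ p := hm'
    have hx : x = p := by simpa using hx
    simp [coneCode, hx, hm, hm']
  · intro m hm x hx
    have hm : m ≠ p := hm
    have hx : x = p := by simpa using hx
    simp [coneCode, hx, hm]
  · intro x hx y hy
    have hx : x = p := by simpa using hx
    have hy : y = p := by simpa using hy
    simp [coneCode, hx, hy]

open Classical in
theorem coneCode_zero_eq (ε : ZMod 3) (p : I) : coneCode ε p (fun _ _ => 0) =
    fun x y => (if x = p then ε else 0) - if y = p then ε else 0 := by
  funext x y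
  unfold coneCode
  split_ifs <;> simp

theorem AllStrongEquiv.strongEquiv_cone_neg [Finite I] (hS : AllStrongEquiv G k)
    (hG : IsTurnGroup G) (hI : Nat.card I = k + 1) {ε : ZMod 3} (hε : ε ≠ 0) {p q : I}
    (hpq : p ≠ q) :
    StrongEquiv G (coneCode ε p fun _ _ => 0) (coneCode (-ε) q fun _ _ => 0) := by
  classical
  have h := isPosCode_zero.coneCode hε p
  rw [coneCode_zero_eq] at h ⊢
  have := hS.strongEquiv_cone hG hI h (p := q) (q := p) (by simp [hpq.symm, hε.symm])
  simpa [hpq.symm] using this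

theorem AllStrongEquiv.strongEquiv_cone_cone [Finite I] (hS : AllStrongEquiv G k)
    (hG : IsTurnGroup G) (hk : 2 ≤ k) (hI : Nat.card I = k + 1) {ε ε' : ZMod 3} (hε : ε ≠ 0)
    (hε' : ε' ≠ 0) (p r : I) :
    StrongEquiv G (coneCode ε p fun _ _ => 0) (coneCode ε' r fun _ _ => 0) := by
  classical
  have := Fintype.ofFinite I
  have hthird : ∀ x y : I, ∃ z, z ≠ x ∧ z ≠ y := fun x y => by
    obtain ⟨z, hz⟩ : ∃ z, z ∉ ({x, y} : Finset I) := by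
      by_contra! hcon
      have : Nat.card I ≤ 2 := by
        rw [Nat.card_eq_fintype_card, ← Finset.card_univ]
        exact (Finset.card_le_card fun z _ => hcon z).trans Finset.card_le_two
      omega
    exact ⟨z, by simpa using hz⟩
  have same : ∀ (ε : ZMod 3), ε ≠ 0 → ∀ p p' : I,
      StrongEquiv G (coneCode ε p fun _ _ => 0) (coneCode ε p' fun _ _ => 0) := by
    intro ε hε p p'
    obtain ⟨q, hq, hq'⟩ := hthird p p'
    exact (hS.strongEquiv_cone_neg hG hI hε hq.symm).trans hG
      (hS.strongEquiv_cone_neg hG hI hε hq'.symm).symm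
  have hcase : ∀ ε ε' : ZMod 3, ε ≠ 0 → ε' ≠ 0 → ε' = ε ∨ ε' = -ε := by decide
  rcases hcase ε ε' hε hε' with rfl | rfl
  · exact same _ hε p r
  · obtain ⟨q, hq, -⟩ := hthird p r
    exact (hS.strongEquiv_cone_neg hG hI hε hq.symm).trans hG (same _ hε' q r)

/-- Some nontrivial code on `k + 1` points is strongly equivalent to the antichain. -/
theorem AllStrongEquiv.exists_strongEquiv_zero [Finite I] (hS : AllStrongEquiv G k)
    (hG : IsTurnGroup G) (hKL : HasStrengthening G) (hk : 2 ≤ k) (hI : Nat.card I = k + 1)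
    (p : I) : ∃ (φ : I → ZMod 3) (p q : I), IsPosCode (fun i j => φ i - φ j) ∧ φ p ≠ φ q ∧
      StrongEquiv G (fun i j => φ i - φ j) fun _ _ => 0 := by
  classical
  have := Fintype.ofFinite I
  have h10 : (1 : ZMod 3) ≠ 0 := by decide
  have hV := (isPosCode_zero (I := I)).coneCode h10 p
  let V := coneCode 1 p fun _ _ : I => (0 : ZMod 3)
  let D : Option I → Option I → ZMod 3 := optionCode V fun _ => 0
  have hD : IsPosCode D := isPosCode_optionCode hV fun i j =>
    ⟨fun _ h => absurd h (by decide), fun _ h => absurd h (by decide),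
      fun h => absurd h (by decide)⟩
  have hD0 : CodeEquiv G D fun _ _ => 0 := by
    refine hS.codeEquiv hG hD isPosCode_zero {none, some p} ?_
      (fun x => if x = some p then -1 else 0) (fun _ => 0) ?_ (by simp) ?_
    · exact (Set.ncard_pair (by simp)).le.trans hk
    · rintro m hm x hx
      obtain ⟨hx0, hxp⟩ : x ≠ none ∧ x ≠ some p := by simpa using hx
      obtain ⟨y, rfl⟩ := Option.ne_none_iff_exists'.1 hx0
      have hyp : y ≠ p := fun h => hxp (by rw [h])
      rcases hm with rfl | rfl
      · simp [D, optionCode, hyp]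
      · simp [D, V, optionCode, coneCode, hyp]
    · rintro x hx y hy
      obtain ⟨hx0, hxp⟩ : x ≠ none ∧ x ≠ some p := by simpa using hx
      obtain ⟨hy0, hyp⟩ : y ≠ none ∧ y ≠ some p := by simpa using hy
      obtain ⟨x, rfl⟩ := Option.ne_none_iff_exists'.1 hx0
      obtain ⟨y, rfl⟩ := Option.ne_none_iff_exists'.1 hy0
      have hxp : x ≠ p := fun h => hxp (by rw [h])
      have hyp : y ≠ p := fun h => hyp (by rw [h])
      simp [D, V, optionCode, coneCode, hxp, hyp]
  obtain ⟨κ'', φ, hκ, hφ, hstr⟩ := hKL _ _ _ hD0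
  obtain rfl : κ'' = fun i j => φ i - φ j := by
    funext i j
    rw [hφ, zero_add]
  let f : I → I → Option I := fun x y => if y = x then none else some y
  have hf : ∀ x, Function.Injective (f x) := fun x y z hyz => by
    simp only [f] at hyz
    split_ifs at hyz with h1 h2 h2
    · rw [h1, h2]
    · exact Option.some_injective _ hyz
  have hDf : ∀ x, StrongEquiv G (fun y z => D (f x y) (f x z)) fun _ _ => 0 := fun x => by
    refine hS.strongEquiv hG (hD.comap _) isPosCode_zero {x}ᶜ ?_ ?_ ?_ ?_
    · rw [Set.ncard_compl, Set.ncard_singleton, hI, Nat.add_sub_cancel]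
    · intro m hm m' hm' y hy
      have hm : m ≠ x := hm
      have hm' : m' ≠ x := hm'
      obtain rfl : y = x := by simpa using hy
      simp [D, f, optionCode, hm, hm']
    · intro m hm y hy
      have hm : m ≠ x := hm
      obtain rfl : y = x := by simpa using hy
      simp [D, f, optionCode, hm]
    · intro y hy z hz
      obtain rfl : y = x := by simpa using hy
      obtain rfl : z = y := by simpa using hz
      simp [hD.self]
  by_cases hconst : ∃ x y z, φ (f x y) ≠ φ (f x z)
  · obtain ⟨x, y, z, hyz⟩ := hconst
    exact ⟨fun y => φ (f x y), y, z, hκ.comap (f x), hyz,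
      (hstr.comap (hf x)).symm.trans hG (hDf x)⟩
  push Not at hconst
  have hsome : ∀ x y, φ (some x) = φ (some y) := by
    intro x y
    obtain ⟨z, hz⟩ : ∃ z, z ∉ ({x, y} : Finset I) := by
      by_contra! hcon
      have : Nat.card I ≤ 2 := by
        rw [Nat.card_eq_fintype_card, ← Finset.card_univ]
        exact (Finset.card_le_card fun z _ => hcon z).trans Finset.card_le_two
      omega
    simp only [Finset.mem_insert, Finset.mem_singleton, not_or] at hz
    simpa [f, Ne.symm hz.1, Ne.symm hz.2] using hconst z x y
  obtain ⟨q, hq⟩ : ∃ q, q ≠ p := by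
    by_contra! hcon
    have : Nat.card I ≤ 1 := by
      rw [Nat.card_eq_fintype_card, ← Finset.card_univ, ← Finset.card_singleton p]
      exact Finset.card_le_card fun z _ => by simp [hcon z]
    omega
  have hVs := hstr.comap (Option.some_injective I)
  refine ⟨fun x => if x = p then 1 else 0, p, q, ?_, by simp [hq], ?_⟩
  · rwa [coneCode_zero_eq] at hV
  · convert hVs using 1
    · exact (coneCode_zero_eq 1 p).symm
    · funext x y
      rw [hsome x y, sub_self]

end Cones

section Endgame

variable {G : Subgroup (Equiv.Perm P)} {k : ℕ}

theorem AllStrongEquiv.succ (hS : AllStrongEquiv G k) (hG : IsTurnGroup G)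
    (hKL : HasStrengthening G) (hk : 2 ≤ k) : AllStrongEquiv G (k + 1) := by
  refine allStrongEquiv_of_zero hG fun I _ hI κ hκ => ?_
  rcases Nat.le_or_eq_of_le_succ hI with hI | hI
  · exact hS I hI _ _ hκ isPosCode_zero
  have : Nonempty I := (Nat.card_pos_iff.1 (by omega)).1
  obtain ⟨p₀⟩ := this
  obtain ⟨κ'', φ, hκ'', hφ, hstr⟩ := hKL _ _ _ (hS.codeEquiv_zero_of_card_succ hG hI hκ)
  obtain rfl : κ'' = fun i j => φ i - φ j := by
    funext i j
    rw [hφ, zero_add]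
  by_cases hne : ∃ p q, φ p ≠ φ q
  · obtain ⟨p, q, hpq⟩ := hne
    obtain ⟨ψ, r, s, hψ, hrs, hψ0⟩ := hS.exists_strongEquiv_zero hG hKL hk hI p₀
    exact hstr.trans hG ((hS.strongEquiv_cone hG hI hκ'' hpq).trans hG
      ((hS.strongEquiv_cone_cone hG hk hI (sub_ne_zero.2 hpq) (sub_ne_zero.2 hrs) p r).trans hG
        ((hS.strongEquiv_cone hG hI hψ hrs).symm.trans hG hψ0)))
  · push Not at hne
    convert hstr using 1
    funext i j
    rw [hne i j, sub_self]

/-- A code of two comparable points that is strongly equivalent to the antichain. -/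
theorem allStrongEquiv_two {I : Type} (hG : IsTurnGroup G) {κ : I → I → ZMod 3} {i j : I}
    (hij : κ i j ≠ 0) (h : StrongEquiv G (fun _ _ => 0) κ) : AllStrongEquiv G 2 := by
  classical
  have hκ := h.codeEquiv.isPosCode_right
  wlog h1 : κ i j = 1 generalizing i j
  · refine this (i := j) (j := i) ?_ ?_
    · rw [hκ.swap i j]
      exact neg_ne_zero.2 hij
    · rw [hκ.swap i j]
      revert hij h1
      generalize κ i j = x
      revert x
      decide
  have hne : i ≠ j := by
    rintro rfl
    exact hij (hκ.self i)
  refine allStrongEquiv_of_zero hG fun J _ hJ l hl => ?_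
  by_cases hl0 : ∀ x y, l x y = 0
  · rw [show l = fun _ _ => 0 from funext₂ hl0]
    exact StrongEquiv.refl hG isPosCode_zero
  push Not at hl0
  obtain ⟨x, y, hxy, hlxy⟩ : ∃ x y, x ≠ y ∧ l x y = 1 := by
    obtain ⟨x, y, hxy⟩ := hl0
    have hne : x ≠ y := by
      rintro rfl
      exact hxy (hl.self x)
    rcases ZMod3_cases (l x y) with h0 | h0 | h0
    · exact absurd h0 hxy
    · exact ⟨x, y, hne, h0⟩
    · exact ⟨y, x, hne.symm, by rw [hl.swap x y, h0, neg_neg]⟩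
  have := Fintype.ofFinite J
  have hall : ∀ z, z = x ∨ z = y := by
    by_contra! hcon
    obtain ⟨z, hzx, hzy⟩ := hcon
    have := Finset.card_le_univ ({z, x, y} : Finset J)
    rw [Finset.card_eq_three.2 ⟨z, x, y, hzx, hzy, hxy, rfl⟩, ← Nat.card_eq_fintype_card] at this
    omega
  have hf : Function.Injective fun z => if z = x then i else j := by
    intro z w hzw
    rcases hall z with rfl | rfl <;> rcases hall w with rfl | rfl <;>
      simp_all [hxy.symm, hne.symm]
  have := (h.comap hf).symm
  convert this using 1
  funext z w
  rcases hall z with rfl | rfl <;> rcases hall w with rfl | rfl <;>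
    simp [hl.self, hκ.self, hxy.symm, h1, hlxy]
  rw [hl.swap w z, hκ.swap i j, h1, hlxy]

theorem exists_ne_zero_of_cycSum_ne_zero {I : Type} {κ : I → I → ZMod 3} {a b c : I}
    (h : cycSum κ a b c ≠ 0) : ∃ i j, κ i j ≠ 0 := by
  by_contra! hcon
  exact h (by simp [cycSum, hcon])

/-- A violation of `Pari` yields a cyclically nontrivial code equivalent to the antichain. -/
theorem exists_codeEquiv_zero_of_cycSum (hG : IsTurnGroup G) {g : Equiv.Perm P} (hg : g ∈ G)
    {a b c : P} (h0 : cycSum ordCode a b c = 0)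
    (h : cycSum ordCode (g a) (g b) (g c) ≠ 0) :
    ∃ κ : Fin 3 → Fin 3 → ZMod 3, CodeEquiv G (fun _ _ => 0) κ ∧ cycSum κ 0 1 2 ≠ 0 := by
  have hpos := isPosCode_ordCode (P := P)
  obtain ⟨hab, hbc, hac⟩ := cycSum_ne_zero_ne h
  have hinj : Function.Injective ![a, b, c] := by
    have hab : a ≠ b := fun e => hab (by rw [e])
    have hbc : b ≠ c := fun e => hbc (by rw [e])
    have hac : a ≠ c := fun e => hac (by rw [e])
    intro i j hij
    fin_cases i <;> fin_cases j <;> simp_all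
  have he := codeEquiv_of_mem hinj hg
  refine ⟨_, hG.codeEquiv_trans (hG.codeEquiv_of_eq_add_sub he.isPosCode_left isPosCode_zero
    (fun i => ordCode a (![a, b, c] i)) fun i j => ?_).symm he, h⟩
  have hba := hpos.swap a b
  have hca := hpos.swap a c
  have hcb := hpos.swap b c
  rw [cycSum, hca] at h0
  fin_cases i <;> fin_cases j <;> simp [hpos.self, hba, hca, hcb]
  · linear_combination -h0
  · linear_combination h0

theorem allStrongEquiv_two_of_not_preserves3 (hG : IsTurnGroup G) (hKL : HasStrengthening G)
    {g : Equiv.Perm P} (hg : g ∈ G) (hgP : ¬ Preserves3 g Pari) : AllStrongEquiv G 2 := by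
  obtain ⟨κ, hκ, hcyc⟩ :
      ∃ κ : Fin 3 → Fin 3 → ZMod 3, CodeEquiv G (fun _ _ => 0) κ ∧ cycSum κ 0 1 2 ≠ 0 := by
    rw [preserves3_pari_iff] at hgP
    push Not at hgP
    obtain ⟨a, b, c, ⟨h, h'⟩ | ⟨h, h'⟩⟩ := hgP
    · exact exists_codeEquiv_zero_of_cycSum hG (G.inv_mem hg) h (by simpa using h')
    · exact exists_codeEquiv_zero_of_cycSum hG hg h' h
  obtain ⟨κ'', φ, hκ'', hφ, hstr⟩ := hKL _ _ _ hκ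
  have : cycSum κ'' 0 1 2 ≠ 0 := by
    convert hcyc using 1
    simp only [cycSum, hφ]
    ring
  obtain ⟨i, j, hij⟩ := exists_ne_zero_of_cycSum_ne_zero this
  exact allStrongEquiv_two hG hij hstr

theorem allStrongEquiv_of_two (hG : IsTurnGroup G) (hKL : HasStrengthening G)
    (h : AllStrongEquiv G 2) (k : ℕ) : AllStrongEquiv G (k + 2) := by
  induction k with
  | zero => exact h
  | succ k ih => exact ih.succ hG hKL (by omega)

end Endgame

/-- A closed group strictly above the group of rotations contains every
`Pari`-preserving permutation. -/
theorem closed_group_above_turn [Countable P] [Infinite P]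
    (hU : IsUniversal P) (hH : IsHomogeneous P)
    (G : Subgroup (Equiv.Perm P)) (hG : IsClosedSubgroup G)
    (hT : ∀ f : Equiv.Perm P, IsRotation f → f ∈ G)
    (hne : ∃ f ∈ G, ¬ IsRotation f) :
    ∀ f : Equiv.Perm P, Preserves3 (⇑f) Pari → f ∈ G := by
  intro f hf
  have hTurn : IsTurnGroup G := ⟨inferInstance, hU, hH, hG, hT⟩
  by_cases hP : ∀ g ∈ G, Preserves3 g Pari
  · exact hTurn.mem_of_forall_preserves3 hP hne hf
  push Not at hP
  obtain ⟨g, hg, hgP⟩ := hP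
  by_cases hR : ∀ (J : Type) [Finite J] (ρ : J → J → ZMod 3), IsPosCode ρ →
      CodeEquiv G ρ fun i j => -ρ i j
  · exact hTurn.mem_of_forall_codeEquiv_neg hR hf
  by_cases hA : ∀ k, AllCodeEquiv G k
  · exact hTurn.mem_of_forall_allCodeEquiv hA f
  have hKL : HasStrengthening G := fun I _ κ κ' h =>
    (hTurn.strongEquiv_or h).resolve_right fun h => h.elim hR hA
  have h2 := allStrongEquiv_two_of_not_preserves3 hTurn hKL hg hgP
  refine absurd (fun k => ?_) hA
  intro I _ hI κ κ' hκ hκ'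
  exact (allStrongEquiv_of_two hTurn hKL h2 k I (by omega) κ κ' hκ hκ').codeEquiv
end

section
/- A permutation f of P satisfies (a ⊥ b ⟺ f(a) ⊥ f(b) for all a, b ∈ P) if and only if f is an order-automorphism of P or an anti-automorphism of P. -/
variable {P : Type} [PartialOrder P]

theorem Perp.symm {a b : P} (h : Perp a b) : Perp b a := ⟨h.2, h.1⟩

theorem perp_or_lt_or_eq (a b : P) : Perp a b ∨ a < b ∨ b < a ∨ a = b := by
  by_cases h : a ≤ b
  · have := h.lt_or_eq
    tauto
  · by_cases h' : b ≤ a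
    · have := h'.lt_or_eq
      tauto
    · exact .inl ⟨h, h'⟩

/-- The relation on `Option S` that places the new point `none` above exactly the elements
of `D`. -/
def OptionLE (S : Finset P) (D : Set P) : Option S → Option S → Prop
  | some s, some t => s ≤ t
  | some s, none => (s : P) ∈ D
  | none, some _ => False
  | none, none => True

/-- `OptionLE S D` is a partial order when `D` is downward closed in `S`. -/
@[reducible] def optionPartialOrder (S : Finset P) (D : Set P)
    (hD : ∀ s ∈ S, ∀ t ∈ S, s ≤ t → t ∈ D → s ∈ D) : PartialOrder (Option S) where
  le := OptionLE S D
  lt x y := OptionLE S D x y ∧ ¬ OptionLE S D y x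
  le_refl x := by cases x <;> simp [OptionLE]
  le_trans x y z hxy hyz := by
    rcases x with _ | x <;> rcases y with _ | y <;> rcases z with _ | z <;>
      simp only [OptionLE] at *
    · exact hxy
    · exact hD x x.2 y y.2 hxy hyz
    · exact hxy.trans hyz
  le_antisymm x y hxy hyx := by
    rcases x with _ | x <;> rcases y with _ | y <;> simp only [OptionLE] at *
    rw [le_antisymm hxy hyx]

/-- One-point extension: a finite `S` with a downward closed subset `D` has a point above the
elements of `D` and incomparable to the rest of `S`. -/
theorem exists_above_perp (hU : IsUniversal P) (hH : IsHomogeneous P) (S : Finset P) (D : Set P)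
    (hD : ∀ s ∈ S, ∀ t ∈ S, s ≤ t → t ∈ D → s ∈ D) :
    ∃ w, ∀ s ∈ S, (s ∈ D → s < w) ∧ (s ∉ D → Perp s w) := by
  let _ := optionPartialOrder S D hD
  obtain ⟨e⟩ := hU (Option S)
  let i : (S : Set P) ↪o P :=
    OrderEmbedding.ofMapLEIff (fun s => e (some s)) fun s t => e.le_iff_le
  have hT : Set.range i = ((Set.finite_range i).toFinset : Set P) := by simp
  obtain ⟨g, hg⟩ := hH S _ (i.orderIso.trans (OrderIso.setCongr _ _ hT))
  have hg' : ∀ s (hs : s ∈ S), g s = e (some ⟨s, hs⟩) := fun s hs => hg ⟨s, hs⟩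
  have hle : ∀ s ∈ S, s ≤ g.symm (e none) ↔ s ∈ D := fun s hs => by
    rw [g.le_symm_apply, hg' s hs, e.le_iff_le]; rfl
  have hnle : ∀ s ∈ S, ¬ g.symm (e none) ≤ s := fun s hs => by
    rw [g.symm_apply_le, hg' s hs, e.le_iff_le]; exact id
  exact ⟨g.symm (e none), fun s hs =>
    ⟨fun h => lt_of_le_not_ge ((hle s hs).2 h) (hnle s hs),
      fun h => ⟨fun h' => h ((hle s hs).1 h'), hnle s hs⟩⟩⟩

section PerpPreserving

variable {f : Equiv.Perm P} (hf : ∀ a b : P, Perp a b ↔ Perp (f a) (f b))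

include hf

theorem lt_or_gt_of_perp_preserving {a b : P} (h : a < b) : f a < f b ∨ f b < f a := by
  rcases perp_or_lt_or_eq (f a) (f b) with h' | h' | h' | h'
  · exact absurd h.le ((hf a b).2 h').1
  · exact .inl h'
  · exact .inr h'
  · exact absurd (f.injective h') h.ne

theorem map_lt_of_common_lower {a b c : P} (hc : a < c) (hbc : Perp b c)
    (h : f a < f b) : f a < f c :=
  (lt_or_gt_of_perp_preserving hf hc).resolve_right fun h' =>
    ((hf b c).1 hbc).2 (h'.trans h).le

theorem map_lt_of_common_upper {a b c : P} (hb : b < c) (hab : Perp a b)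
    (h : f a < f c) : f b < f c :=
  (lt_or_gt_of_perp_preserving hf hb).resolve_right fun h' =>
    ((hf a b).1 hab).1 (h.trans h').le

theorem map_lt_of_perp_pairs (hU : IsUniversal P) (hH : IsHomogeneous P) {a b x y : P}
    (hab : a < b) (hxy : x < y) (hax : Perp a x) (hay : Perp a y) (hbx : Perp b x)
    (h : f a < f b) : f x < f y := by
  classical
  obtain ⟨w, hw⟩ := exists_above_perp hU hH {a, b, x, y} {a, x} (by
    simp only [Finset.mem_insert, Finset.mem_singleton, Set.mem_insert_iff,
      Set.mem_singleton_iff]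
    unfold Perp at *
    grind)
  have ha := (hw a (by simp)).1 (by simp)
  have hx := (hw x (by simp)).1 (by simp)
  have hb : Perp b w := (hw b (by simp)).2 (by
    rintro (rfl | rfl)
    · exact hab.false
    · exact hbx.1 le_rfl)
  have hy : Perp y w := (hw y (by simp)).2 (by
    rintro (rfl | rfl)
    · exact hay.1 le_rfl
    · exact hxy.false)
  exact map_lt_of_common_lower hf hxy hy.symm
    (map_lt_of_common_upper hf hx hax (map_lt_of_common_lower hf ha hb h))

theorem map_lt_of_map_lt (hU : IsUniversal P) (hH : IsHomogeneous P) {a b c d : P}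
    (hab : a < b) (hcd : c < d) (h : f a < f b) : f c < f d := by
  classical
  obtain ⟨x, hx⟩ := exists_above_perp hU hH {a, b, c, d} ∅ (by simp)
  replace hx : ∀ s ∈ ({a, b, c, d} : Finset P), Perp s x := fun s hs => (hx s hs).2 (by simp)
  obtain ⟨y, hy⟩ := exists_above_perp hU hH (insert x {a, b, c, d}) {x} (by
    intro s hs t _ hst ht
    obtain rfl : t = x := ht
    exact (Finset.mem_insert.1 hs).resolve_right fun h' => (hx s h').1 hst)
  have hxy : x < y := (hy x (Finset.mem_insert_self _ _)).1 rfl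
  replace hy : ∀ s ∈ ({a, b, c, d} : Finset P), Perp s y := fun s hs =>
    (hy s (Finset.mem_insert_of_mem hs)).2 fun h' => (hx s hs).1 (le_of_eq h')
  exact map_lt_of_perp_pairs hf hU hH hxy hcd (hx c (by simp)).symm (hx d (by simp)).symm
    (hy c (by simp)).symm (map_lt_of_perp_pairs hf hU hH hab hxy (hx a (by simp))
      (hy a (by simp)) (hx b (by simp)) h)

theorem isOrderAuto_of_map_lt (h : ∀ a b : P, a < b → f a < f b) : IsOrderAuto f := by
  intro a b
  rcases perp_or_lt_or_eq a b with h' | h' | h' | rfl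
  · exact iff_of_false ((hf a b).1 h').1 h'.1
  · exact iff_of_true (h a b h').le h'.le
  · exact iff_of_false (h b a h').not_ge h'.not_ge
  · simp

theorem isAntiAuto_of_map_gt (h : ∀ a b : P, a < b → f b < f a) : IsAntiAuto f := by
  intro a b
  rcases perp_or_lt_or_eq a b with h' | h' | h' | rfl
  · exact iff_of_false ((hf a b).1 h').1 h'.2
  · exact iff_of_false (h a b h').not_ge h'.not_ge
  · exact iff_of_true (h b a h').le h'.le
  · simp

end PerpPreserving

/-- A permutation preserves incomparability (in both directions) iff it is an
order-automorphism or an anti-automorphism. -/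
theorem perp_preserving_iff [Countable P] [Infinite P]
    (hU : IsUniversal P) (hH : IsHomogeneous P) (f : Equiv.Perm P) :
    (∀ a b : P, Perp a b ↔ Perp (f a) (f b)) ↔
      (IsOrderAuto f ∨ IsAntiAuto f) := by
  constructor
  · intro hf
    by_cases h : ∃ a b : P, a < b ∧ f a < f b
    · obtain ⟨a, b, hab, h⟩ := h
      exact .inl (isOrderAuto_of_map_lt hf fun c d hcd => map_lt_of_map_lt hf hU hH hab hcd h)
    · exact .inr (isAntiAuto_of_map_gt hf fun a b hab =>
        (lt_or_gt_of_perp_preserving hf hab).resolve_left fun h' => h ⟨a, b, hab, h'⟩)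
  · rintro (h | h) a b
    · simp only [Perp, h a b, h b a]
    · simp only [Perp, h a b, h b a, and_comm]
end
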